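/- arXiv:2506.03544 — 6 statements merged into one kernel-verified Lean document; each statement's English description precedes it below -/
import Mathlib

section
/- Let H be a graph with wpn(H) ≥ 1 and let (F_1,…,F_{wpn(H)}) be a really canonical H-freeness witnessing wpn(H)-sequence. Then for every index i, the set J_i of graphs that are induced subgraphs of H but do not belong to F_i contains a bipartite graph, the complement of a bipartite graph, and a split graph. -/
open SimpleGraph Filter

/-- `G` contains no induced copy of `H`. -/
def IndFree {W V : Type*} (H : SimpleGraph W) (G : SimpleGraph V) : Prop :=
  ¬ Nonempty (H ↪g G)

/-- A class of finite graphs: a predicate on graphs over every finite vertex type. -/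
abbrev GraphClass : Type 1 := ∀ (V : Type) [Finite V], SimpleGraph V → Prop

/-- A class of finite graphs is hereditary if it is closed under isomorphism and
under taking induced subgraphs (equivalently, closed under induced-subgraph
embeddings). -/
def GraphClass.Hereditary (F : GraphClass) : Prop :=
  ∀ (V W : Type) [Finite V] [Finite W] (G : SimpleGraph V) (L : SimpleGraph W),
    Nonempty (L ↪g G) → F V G → F W L

/-- The class contains all complete graphs. -/
def GraphClass.ContainsAllCliques (F : GraphClass) : Prop :=
  ∀ (V : Type) [Finite V], F V ⊤

/-- The class contains all edgeless graphs. -/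
def GraphClass.ContainsAllStables (F : GraphClass) : Prop :=
  ∀ (V : Type) [Finite V], F V ⊥

/-- `(F 0, …, F (k-1))` is an `H`-freeness witnessing `k`-sequence: a sequence of
hereditary classes such that for every partition of `V(H)` into `k` parts some part
induces a graph outside the corresponding class. -/
def IsWitnessingSeq {VH : Type} [Finite VH] (H : SimpleGraph VH) (k : ℕ)
    (F : Fin k → GraphClass) : Prop :=
  (∀ i, (F i).Hereditary) ∧
  ∀ X : VH → Fin k, ∃ i, ¬ F i ↥{v | X v = i} (H.induce {v | X v = i})

/-- `F` is canonical for `H`: there is a set `J` of induced subgraphs of `H` such that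
`F` is exactly the class of graphs containing no induced copy of a member of `J`. -/
def IsCanonicalFor {VH : Type} [Finite VH] (H : SimpleGraph VH) (F : GraphClass) : Prop :=
  ∃ J : GraphClass,
    (∀ (W : Type) [Finite W] (L : SimpleGraph W), J W L → Nonempty (L ↪g H)) ∧
    ∀ (V : Type) [Finite V] (G : SimpleGraph V),
      F V G ↔ ∀ (W : Type) [Finite W] (L : SimpleGraph W), J W L → IndFree L G

/-- A really canonical `H`-freeness witnessing `k`-sequence: a witnessing sequence in
which each class is canonical and contains all cliques or all stable sets. -/
def IsReallyCanonicalSeq {VH : Type} [Finite VH] (H : SimpleGraph VH) (k : ℕ)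
    (F : Fin k → GraphClass) : Prop :=
  IsWitnessingSeq H k F ∧
  ∀ i, IsCanonicalFor H (F i) ∧
    ((F i).ContainsAllCliques ∨ (F i).ContainsAllStables)

/-- `V(H)` can be partitioned into `c` cliques and `s` stable sets. -/
def HasCSPartition {VH : Type} (H : SimpleGraph VH) (c s : ℕ) : Prop :=
  ∃ f : VH → (Fin c ⊕ Fin s),
    (∀ i : Fin c, H.IsClique {v | f v = Sum.inl i}) ∧
    (∀ j : Fin s, ∀ a, f a = Sum.inr j → ∀ b, f b = Sum.inr j → ¬ H.Adj a b)

/-- `r` is the witnessing partition number of `H`: the greatest `m` such that for some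
`c + s = m` there is no partition of `V(H)` into `c` cliques and `s` stable sets. -/
def IsWpn {VH : Type} (H : SimpleGraph VH) (r : ℕ) : Prop :=
  IsGreatest {m | ∃ c s : ℕ, c + s = m ∧ ¬ HasCSPartition H c s} r

/-- Partition into parts indexed by an arbitrary finite type, with prescribed part types. -/
lemma exists_typed_partition {VH : Type} (H : SimpleGraph VH) (r : ℕ) (hr : IsWpn H r)
    (σ : Option (Fin r) → Bool) :
    ∃ f : VH → Option (Fin r), ∀ a b, a ≠ b → f a = f b →
      (H.Adj a b ↔ σ (f a) = true) := by
  classical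
  let c := Fintype.card {t // σ t = true}
  let s := Fintype.card {t // ¬ σ t = true}
  have hcs : c + s = r + 1 := by
    have h := Fintype.card_congr (Equiv.sumCompl (fun t => σ t = true))
    rw [Fintype.card_sum, Fintype.card_option, Fintype.card_fin] at h
    exact h
  have hP : HasCSPartition H c s := by
    by_contra hn
    have := hr.2 ⟨c, s, hcs, hn⟩
    omega
  obtain ⟨f, h1, h2⟩ := hP
  let ec : {t // σ t = true} ≃ Fin c := Fintype.equivFin _
  let es : {t // ¬ σ t = true} ≃ Fin s := Fintype.equivFin _
  let e : Fin c ⊕ Fin s ≃ Option (Fin r) :=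
    (Equiv.sumCongr ec es).symm.trans (Equiv.sumCompl (fun t => σ t = true))
  refine ⟨fun v => e (f v), fun a b hab hf => ?_⟩
  have hf' : f a = f b := e.injective hf
  rcases hfa : f a with i | j
  · have : σ (e (Sum.inl i)) = true := (ec.symm i).2
    simp only [hfa, this, iff_true]
    exact h1 i hfa (hf'.symm.trans hfa) hab
  · have : ¬ σ (e (Sum.inr j)) = true := (es.symm j).2
    simp only [hfa]
    refine iff_of_false ?_ this
    exact h2 j a hfa b (hf'.symm.trans hfa)

/-- Some part `S` outside `F i` splits into two pieces of prescribed types. -/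
lemma exists_bad_part {VH : Type} [Finite VH] (H : SimpleGraph VH) (r : ℕ)
    (hr : IsWpn H r) (F : Fin r → GraphClass) (hF : IsReallyCanonicalSeq H r F)
    (i : Fin r) (p q : Bool) :
    ∃ (S : Set VH) (g : VH → Bool), ¬ F i S (H.induce S) ∧
      ∀ a ∈ S, ∀ b ∈ S, a ≠ b → g a = g b →
        (H.Adj a b ↔ (if g a then p else q) = true) := by
  classical
  let τ : Fin r → Bool := fun j => decide (F j).ContainsAllCliques
  let σ : Option (Fin r) → Bool := fun t =>
    match t with
    | none => q
    | some j => if j = i then p else τ j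
  obtain ⟨f, hf⟩ := exists_typed_partition H r hr σ
  obtain ⟨j, hj⟩ := hF.1.2 (fun v => (f v).getD i)
  have key : j = i := by
    by_contra hne
    have hS : ∀ v, (f v).getD i = j → f v = some j := by
      intro v hv
      rcases h : f v with _ | t
      · rw [h] at hv; exact absurd hv.symm hne
      · rw [h] at hv; simpa using hv
    by_cases hc : (F j).ContainsAllCliques
    · apply hj
      have : H.induce {v | (f v).getD i = j} = ⊤ := by
        ext ⟨a, ha⟩ ⟨b, hb⟩
        have ha' := hS a ha
        have hb' := hS b hb
        simp only [comap_adj, Function.Embedding.subtype_apply, top_adj, ne_eq, Subtype.mk.injEq]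
        constructor
        · exact fun h => h.ne
        · intro h
          rw [hf a b h (ha'.trans hb'.symm), ha']
          simp [σ, τ, hne, hc]
      rw [this]
      exact hc _
    · have hs := (hF.2 j).2.resolve_left hc
      apply hj
      have : H.induce {v | (f v).getD i = j} = ⊥ := by
        ext ⟨a, ha⟩ ⟨b, hb⟩
        have ha' := hS a ha
        have hb' := hS b hb
        simp only [comap_adj, Function.Embedding.subtype_apply, bot_adj, iff_false]
        intro h
        rw [hf a b h.ne (ha'.trans hb'.symm), ha'] at h
        simp [σ, τ, hne, hc] at h
      rw [this]
      exact hs _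
  subst key
  refine ⟨_, fun v => (f v).isSome, hj, ?_⟩
  intro a ha b hb hab hg
  have ha' : (f a).getD j = j := ha
  have hb' : (f b).getD j = j := hb
  rcases h1 : f a with _ | t <;> rcases h2 : f b with _ | u <;>
    simp only [h1, h2, Option.getD_some, Option.isSome_some, Option.isSome_none] at ha' hb' hg
  · rw [hf a b hab (h1.trans h2.symm), h1]; simp [σ, h1]
  · simp at hg
  · simp at hg
  · subst ha' hb'
    rw [hf a b hab (h1.trans h2.symm), h1]; simp [σ, h1]

/-- For every really canonical `H`-freeness witnessing `wpn(H)`-sequence, each set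
`J i` of induced subgraphs of `H` not belonging to `F i` contains a bipartite graph,
the complement of a bipartite graph, and a split graph. -/
theorem stmt_5 {VH : Type} [Finite VH] (H : SimpleGraph VH) (r : ℕ)
    (hr : IsWpn H r) (hr1 : 1 ≤ r)
    (F : Fin r → GraphClass) (hF : IsReallyCanonicalSeq H r F) :
    ∀ i : Fin r,
      (∃ (W : Type) (_ : Finite W) (L : SimpleGraph W),
          (Nonempty (L ↪g H) ∧ ¬ F i W L) ∧ L.Colorable 2) ∧
      (∃ (W : Type) (_ : Finite W) (L : SimpleGraph W),
          (Nonempty (L ↪g H) ∧ ¬ F i W L) ∧ Lᶜ.Colorable 2) ∧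
      (∃ (W : Type) (_ : Finite W) (L : SimpleGraph W),
          (Nonempty (L ↪g H) ∧ ¬ F i W L) ∧
          ∃ K : Set W, L.IsClique K ∧ ∀ a, a ∉ K → ∀ b, b ∉ K → ¬ L.Adj a b) := by
  intro i
  refine ⟨?_, ?_, ?_⟩
  · obtain ⟨S, g, hS, hg⟩ := exists_bad_part H r hr F hF i false false
    refine ⟨S, inferInstance, H.induce S, ⟨⟨Embedding.induce S⟩, hS⟩, ?_⟩
    have C : (H.induce S).Coloring Bool := Coloring.mk (fun v => g v) (by
      intro a b hab he
      have hab' : H.Adj a b := hab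
      have := (hg a a.2 b b.2 hab'.ne he).1 hab'
      simp at this)
    simpa using C.colorable
  · obtain ⟨S, g, hS, hg⟩ := exists_bad_part H r hr F hF i true true
    refine ⟨S, inferInstance, H.induce S, ⟨⟨Embedding.induce S⟩, hS⟩, ?_⟩
    have C : (H.induce S)ᶜ.Coloring Bool := Coloring.mk (fun v => g v) (by
      intro a b hab he
      rw [compl_adj] at hab
      apply hab.2
      exact (hg a a.2 b b.2 (fun h => hab.1 (Subtype.ext h)) he).2 (by simp))
    simpa using C.colorable
  · obtain ⟨S, g, hS, hg⟩ := exists_bad_part H r hr F hF i true false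
    refine ⟨S, inferInstance, H.induce S, ⟨⟨Embedding.induce S⟩, hS⟩,
      {v | g v = true}, ?_, ?_⟩
    · intro a ha b hb hab
      have ha' : g a = true := ha
      have hb' : g b = true := hb
      exact (hg a a.2 b b.2 (fun h => hab (Subtype.ext h)) (ha'.trans hb'.symm)).2 (by simp [ha'])
    · intro a ha b hb hab
      have ha' : g a = false := by simpa using ha
      have hb' : g b = false := by simpa using hb
      have hab' : H.Adj a b := hab
      have := (hg a a.2 b b.2 hab'.ne (ha'.trans hb'.symm)).1 hab'
      simp [ha'] at this
end

section
/- Let (F_1, F_2, F_3) be a really canonical C_8-freeness witnessing 3-sequence. Then one of the following holds: (1) there is an index i such that every graph in F_i has the property that every connected component of its complement is the join of a clique and a stable set, and for each j ≠ i every graph in F_j is complete or is the edgeless graph on two vertices; (2) there are distinct indices i, j, k with {i,j,k} = {1,2,3} such that every graph in F_i is complete or edgeless, every graph in F_j is complete or is the edgeless graph on two vertices, and every graph in F_k is the complement of a matching. -/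
open SimpleGraph Filter

/-- `H` is the join of a clique and a stable set (either part may be empty). -/
def CliqueJoinStable {V : Type*} (H : SimpleGraph V) : Prop :=
  ∃ K : Set V,
    (∀ a ∈ K, ∀ b ∈ K, a ≠ b → H.Adj a b) ∧
    (∀ a, a ∉ K → ∀ b, b ∉ K → ¬ H.Adj a b) ∧
    (∀ a ∈ K, ∀ b, b ∉ K → H.Adj a b)

/-- Every connected component of `H` is the join of a clique and a stable set. -/
def ComponentsCliqueJoinStable {V : Type*} (H : SimpleGraph V) : Prop :=
  ∀ c : H.ConnectedComponent, CliqueJoinStable (H.induce c.supp)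

/-- The induced pattern of `C₈` on the listed vertices. -/
abbrev pat {n : ℕ} (e : Fin n → Fin 8) : SimpleGraph (Fin n) := (cycleGraph 8).comap e

abbrev gK2 : SimpleGraph (Fin 2) := pat ![0, 1]
abbrev gS2 : SimpleGraph (Fin 2) := pat ![0, 2]
abbrev gS3 : SimpleGraph (Fin 3) := pat ![0, 2, 4]
abbrev gP3 : SimpleGraph (Fin 3) := pat ![0, 1, 2]
abbrev gM : SimpleGraph (Fin 3) := pat ![0, 1, 3]
abbrev gS4 : SimpleGraph (Fin 4) := pat ![0, 2, 4, 6]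
abbrev gP4 : SimpleGraph (Fin 4) := pat ![0, 1, 2, 3]
abbrev gPK : SimpleGraph (Fin 4) := pat ![0, 1, 2, 5]
abbrev gKK : SimpleGraph (Fin 4) := pat ![0, 1, 4, 5]

/-- `g` maps the part of colour `c` injectively and faithfully into the pattern `L`. -/
abbrev Fits {n : ℕ} (L : SimpleGraph (Fin n)) (Y : Fin 8 → Fin 3) (c : Fin 3)
    (g : Fin 8 → Fin n) : Prop :=
  ∀ a b : Fin 8, Y a = c → Y b = c →
    (g a = g b → a = b) ∧ (L.Adj (g a) (g b) ↔ (cycleGraph 8).Adj a b)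

lemma fits_mem {F : GraphClass} (hF : F.Hereditary) {n : ℕ} {L : SimpleGraph (Fin n)}
    (hL : F (Fin n) L) {S : Set (Fin 8)} (g : Fin 8 → Fin n)
    (hg : ∀ a b : Fin 8, a ∈ S → b ∈ S →
      (g a = g b → a = b) ∧ (L.Adj (g a) (g b) ↔ (cycleGraph 8).Adj a b)) :
    F S ((cycleGraph 8).induce S) := by
  refine hF _ _ L _ ⟨⟨⟨fun a => g a, ?_⟩, ?_⟩⟩ hL
  · intro a b hab
    exact Subtype.ext ((hg a b a.2 b.2).1 hab)
  · intro a b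
    exact (hg a b a.2 b.2).2

lemma no_part {F : Fin 3 → GraphClass} (hF : IsWitnessingSeq (cycleGraph 8) 3 F)
    {i j l : Fin 3} (hij : i ≠ j) (hil : i ≠ l) (hjl : j ≠ l)
    {n₁ n₂ n₃ : ℕ} {L₁ : SimpleGraph (Fin n₁)} {L₂ : SimpleGraph (Fin n₂)}
    {L₃ : SimpleGraph (Fin n₃)} (Y : Fin 8 → Fin 3)
    (g₁ : Fin 8 → Fin n₁) (g₂ : Fin 8 → Fin n₂) (g₃ : Fin 8 → Fin n₃)
    (h₁ : Fits L₁ Y 0 g₁) (h₂ : Fits L₂ Y 1 g₂) (h₃ : Fits L₃ Y 2 g₃) :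
    F i _ L₁ → F j _ L₂ → F l _ L₃ → False := by
  intro f₁ f₂ f₃
  have hinj : ∀ x y : Fin 3, ![i, j, l] x = ![i, j, l] y → x = y := by
    revert i j l; intros
    rename_i x y _
    fin_cases x <;> fin_cases y <;> simp_all
  obtain ⟨c, hc⟩ := hF.2 (fun v => ![i, j, l] (Y v))
  have hcase : c = i ∨ c = j ∨ c = l := by
    clear hc f₁ f₂ f₃ hinj; revert i j l c; decide
  apply hc
  rcases hcase with rfl | rfl | rfl
  · exact fits_mem (hF.1 _) f₁ g₁ fun a b ha hb => h₁ a b (hinj _ 0 ha) (hinj _ 0 hb)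
  · exact fits_mem (hF.1 _) f₂ g₂ fun a b ha hb => h₂ a b (hinj _ 1 ha) (hinj _ 1 hb)
  · exact fits_mem (hF.1 _) f₃ g₃ fun a b ha hb => h₃ a b (hinj _ 2 ha) (hinj _ 2 hb)

lemma f_SSK {F : Fin 3 → GraphClass} (hF : IsWitnessingSeq (cycleGraph 8) 3 F)
    {i j l : Fin 3} (hij : i ≠ j) (hil : i ≠ l) (hjl : j ≠ l) :
    F i _ gS3 → F j _ gS3 → F l _ gK2 → False :=
  no_part hF hij hil hjl ![2, 2, 0, 1, 0, 1, 0, 1] ![0, 0, 0, 0, 1, 0, 2, 0]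
    ![0, 0, 0, 0, 0, 1, 0, 2] ![0, 1, 0, 0, 0, 0, 0, 0] (by decide) (by decide) (by decide)

lemma f_PPK {F : Fin 3 → GraphClass} (hF : IsWitnessingSeq (cycleGraph 8) 3 F)
    {i j l : Fin 3} (hij : i ≠ j) (hil : i ≠ l) (hjl : j ≠ l) :
    F i _ gP3 → F j _ gP3 → F l _ gK2 → False :=
  no_part hF hij hil hjl ![2, 2, 0, 0, 0, 1, 1, 1] ![0, 0, 0, 1, 2, 0, 0, 0]
    ![0, 0, 0, 0, 0, 0, 1, 2] ![0, 1, 0, 0, 0, 0, 0, 0] (by decide) (by decide) (by decide)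

lemma f_PPS {F : Fin 3 → GraphClass} (hF : IsWitnessingSeq (cycleGraph 8) 3 F)
    {i j l : Fin 3} (hij : i ≠ j) (hil : i ≠ l) (hjl : j ≠ l) :
    F i _ gP3 → F j _ gP3 → F l _ gS2 → False :=
  no_part hF hij hil hjl ![2, 0, 0, 0, 2, 1, 1, 1] ![0, 0, 1, 2, 0, 0, 0, 0]
    ![0, 0, 0, 0, 0, 0, 1, 2] ![0, 0, 0, 0, 1, 0, 0, 0] (by decide) (by decide) (by decide)

lemma f_MMK {F : Fin 3 → GraphClass} (hF : IsWitnessingSeq (cycleGraph 8) 3 F)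
    {i j l : Fin 3} (hij : i ≠ j) (hil : i ≠ l) (hjl : j ≠ l) :
    F i _ gM → F j _ gM → F l _ gK2 → False :=
  no_part hF hij hil hjl ![2, 2, 0, 0, 1, 0, 1, 1] ![0, 0, 0, 1, 0, 2, 0, 0]
    ![0, 0, 0, 0, 2, 0, 0, 1] ![0, 1, 0, 0, 0, 0, 0, 0] (by decide) (by decide) (by decide)

lemma f_MPK {F : Fin 3 → GraphClass} (hF : IsWitnessingSeq (cycleGraph 8) 3 F)
    {i j l : Fin 3} (hij : i ≠ j) (hil : i ≠ l) (hjl : j ≠ l) :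
    F i _ gM → F j _ gP3 → F l _ gK2 → False :=
  no_part hF hij hil hjl ![2, 2, 0, 0, 1, 1, 1, 0] ![0, 0, 0, 1, 0, 0, 0, 2]
    ![0, 0, 0, 0, 0, 1, 2, 0] ![0, 1, 0, 0, 0, 0, 0, 0] (by decide) (by decide) (by decide)

lemma f_MSK {F : Fin 3 → GraphClass} (hF : IsWitnessingSeq (cycleGraph 8) 3 F)
    {i j l : Fin 3} (hij : i ≠ j) (hil : i ≠ l) (hjl : j ≠ l) :
    F i _ gM → F j _ gS3 → F l _ gK2 → False :=
  no_part hF hij hil hjl ![2, 2, 1, 0, 1, 0, 0, 1] ![0, 0, 0, 2, 0, 0, 1, 0]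
    ![0, 0, 0, 0, 1, 0, 0, 2] ![0, 1, 0, 0, 0, 0, 0, 0] (by decide) (by decide) (by decide)

lemma f_P4 {F : Fin 3 → GraphClass} (hF : IsWitnessingSeq (cycleGraph 8) 3 F)
    {i j l : Fin 3} (hij : i ≠ j) (hil : i ≠ l) (hjl : j ≠ l) :
    F i _ gP4 → F j _ gK2 → F l _ gK2 → False :=
  no_part hF hij hil hjl ![0, 0, 0, 0, 1, 1, 2, 2] ![0, 1, 2, 3, 0, 0, 0, 0]
    ![0, 0, 0, 0, 0, 1, 0, 0] ![0, 0, 0, 0, 0, 0, 0, 1] (by decide) (by decide) (by decide)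

lemma f_PK {F : Fin 3 → GraphClass} (hF : IsWitnessingSeq (cycleGraph 8) 3 F)
    {i j l : Fin 3} (hij : i ≠ j) (hil : i ≠ l) (hjl : j ≠ l) :
    F i _ gPK → F j _ gK2 → F l _ gK2 → False :=
  no_part hF hij hil hjl ![0, 0, 0, 1, 1, 0, 2, 2] ![0, 1, 2, 0, 0, 3, 0, 0]
    ![0, 0, 0, 0, 1, 0, 0, 0] ![0, 0, 0, 0, 0, 0, 0, 1] (by decide) (by decide) (by decide)

lemma f_KK {F : Fin 3 → GraphClass} (hF : IsWitnessingSeq (cycleGraph 8) 3 F)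
    {i j l : Fin 3} (hij : i ≠ j) (hil : i ≠ l) (hjl : j ≠ l) :
    F i _ gKK → F j _ gK2 → F l _ gK2 → False :=
  no_part hF hij hil hjl ![0, 0, 1, 1, 0, 0, 2, 2] ![0, 1, 0, 0, 2, 3, 0, 0]
    ![0, 0, 0, 1, 0, 0, 0, 0] ![0, 0, 0, 0, 0, 0, 0, 1] (by decide) (by decide) (by decide)

lemma f_SSS {F : Fin 3 → GraphClass} (hF : IsWitnessingSeq (cycleGraph 8) 3 F)
    {i j l : Fin 3} (hij : i ≠ j) (hil : i ≠ l) (hjl : j ≠ l) :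
    F i _ gS4 → F j _ gS3 → F l _ gS2 → False :=
  no_part hF hij hil hjl ![0, 1, 0, 1, 0, 1, 0, 2] ![0, 0, 1, 0, 2, 0, 3, 0]
    ![0, 0, 0, 1, 0, 2, 0, 0] ![0, 0, 0, 0, 0, 0, 0, 0] (by decide) (by decide) (by decide)

lemma triple {F : GraphClass} (hF : F.Hereditary) (e : Fin 3 → Fin 8) {V : Type} [Finite V]
    {G : SimpleGraph V} (hG : F V G) (a b c : V) (hab : a ≠ b) (hac : a ≠ c) (hbc : b ≠ c)
    (h01 : G.Adj a b ↔ (cycleGraph 8).Adj (e 0) (e 1))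
    (h02 : G.Adj a c ↔ (cycleGraph 8).Adj (e 0) (e 2))
    (h12 : G.Adj b c ↔ (cycleGraph 8).Adj (e 1) (e 2)) : F (Fin 3) (pat e) := by
  refine hF _ _ G _ ⟨⟨⟨![a, b, c], ?_⟩, ?_⟩⟩ hG
  · intro x y hxy
    fin_cases x <;> fin_cases y <;> simp_all
  · intro x y
    have h10 := h01; have h20 := h02; have h21 := h12
    rw [G.adj_comm, (cycleGraph 8).adj_comm] at h10 h20 h21
    fin_cases x <;> fin_cases y <;>
      first
      | exact h01 | exact h02 | exact h12 | exact h10 | exact h20 | exact h21 | simp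

lemma quad {F : GraphClass} (hF : F.Hereditary) (e : Fin 4 → Fin 8) {V : Type} [Finite V]
    {G : SimpleGraph V} (hG : F V G) (a b c d : V) (hab : a ≠ b) (hac : a ≠ c) (hbc : b ≠ c)
    (had : a ≠ d) (hbd : b ≠ d) (hcd : c ≠ d)
    (h01 : G.Adj a b ↔ (cycleGraph 8).Adj (e 0) (e 1))
    (h02 : G.Adj a c ↔ (cycleGraph 8).Adj (e 0) (e 2))
    (h12 : G.Adj b c ↔ (cycleGraph 8).Adj (e 1) (e 2))
    (h03 : G.Adj a d ↔ (cycleGraph 8).Adj (e 0) (e 3))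
    (h13 : G.Adj b d ↔ (cycleGraph 8).Adj (e 1) (e 3))
    (h23 : G.Adj c d ↔ (cycleGraph 8).Adj (e 2) (e 3)) : F (Fin 4) (pat e) := by
  refine hF _ _ G _ ⟨⟨⟨![a, b, c, d], ?_⟩, ?_⟩⟩ hG
  · intro x y hxy
    fin_cases x <;> fin_cases y <;> simp_all
  · intro x y
    have h10 := h01; have h20 := h02; have h21 := h12
    have h30 := h03; have h31 := h13; have h32 := h23
    rw [G.adj_comm, (cycleGraph 8).adj_comm] at h10 h20 h21 h30 h31 h32
    fin_cases x <;> fin_cases y <;>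
      first
      | exact h01 | exact h02 | exact h12 | exact h10 | exact h20 | exact h21
      | exact h03 | exact h13 | exact h23 | exact h30 | exact h31 | exact h32 | simp

section Recognition
variable {F : GraphClass} {V : Type} [Finite V] {G : SimpleGraph V}

lemma mem_S3 (hF : F.Hereditary) (hG : F V G) {a b c : V} (hab : a ≠ b) (hac : a ≠ c) (hbc : b ≠ c)
    (h1 : ¬ G.Adj a b) (h2 : ¬ G.Adj a c) (h3 : ¬ G.Adj b c) : F _ gS3 :=
  triple hF _ hG a b c hab hac hbc (by simp only [h1, false_iff]; decide)
    (by simp only [h2, false_iff]; decide) (by simp only [h3, false_iff]; decide)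

lemma mem_P3 (hF : F.Hereditary) (hG : F V G) {a b c : V} (hab : a ≠ b) (hac : a ≠ c) (hbc : b ≠ c)
    (h1 : G.Adj a b) (h2 : ¬ G.Adj a c) (h3 : G.Adj b c) : F _ gP3 :=
  triple hF _ hG a b c hab hac hbc (by simp only [h1, true_iff]; decide)
    (by simp only [h2, false_iff]; decide) (by simp only [h3, true_iff]; decide)

lemma mem_M (hF : F.Hereditary) (hG : F V G) {a b c : V} (hab : a ≠ b) (hac : a ≠ c) (hbc : b ≠ c)
    (h1 : G.Adj a b) (h2 : ¬ G.Adj a c) (h3 : ¬ G.Adj b c) : F _ gM :=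
  triple hF _ hG a b c hab hac hbc (by simp only [h1, true_iff]; decide)
    (by simp only [h2, false_iff]; decide) (by simp only [h3, false_iff]; decide)

lemma top_or_bot (hF : F.Hereditary) (hP : ¬ F _ gP3) (hM : ¬ F _ gM) (hG : F V G) : G = ⊤ ∨ G = ⊥ := by
  have key : ∀ a b c : V, G.Adj a b → c ≠ a → G.Adj a c := by
    intro a b c hab hca
    by_contra hac
    by_cases hcb : c = b
    · exact hac (hcb ▸ hab)
    by_cases hbc : G.Adj b c
    · exact hP (mem_P3 hF hG hab.ne hca.symm (Ne.symm hcb) hab hac hbc)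
    · exact hM (mem_M hF hG hab.ne hca.symm (Ne.symm hcb) hab hac hbc)
  by_cases h : ∃ a b, G.Adj a b
  · obtain ⟨a, b, hab⟩ := h
    left
    ext x y
    simp only [top_adj]
    refine ⟨fun h => h.ne, fun hxy => ?_⟩
    by_cases hx : x = a
    · subst hx; exact key _ _ _ hab hxy.symm
    · exact key x a y (key _ _ _ hab hx).symm hxy.symm
  · right
    ext x y
    simp only [bot_adj, iff_false]
    exact fun hxy => h ⟨x, y, hxy⟩

lemma top_or_two (hF : F.Hereditary) (hS : ¬ F _ gS3) (hP : ¬ F _ gP3) (hM : ¬ F _ gM) (hG : F V G) :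
    G = ⊤ ∨ (Nat.card V = 2 ∧ G = ⊥) := by
  rcases top_or_bot hF hP hM hG with h | h
  · exact Or.inl h
  by_cases ht : G = ⊤
  · exact Or.inl ht
  refine Or.inr ⟨?_, h⟩
  have : ∃ a b : V, a ≠ b := by
    by_contra hn
    push Not at hn
    apply ht
    ext x y
    simp [hn x y]
  obtain ⟨a, b, hab⟩ := this
  rw [Nat.card_eq_two_iff]
  refine ⟨a, b, hab, ?_⟩
  ext c
  simp only [Set.mem_insert_iff, Set.mem_singleton_iff, Set.mem_univ, iff_true]
  by_contra hc
  push Not at hc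
  subst h
  exact hS (mem_S3 hF hG hab hc.1.symm hc.2.symm (by simp) (by simp) (by simp))

lemma compl_matching (hF : F.Hereditary) (hS : ¬ F _ gS3) (hM : ¬ F _ gM) (hG : F V G) :
    ∀ a b c : V, Gᶜ.Adj a b → Gᶜ.Adj a c → b = c := by
  intro a b c hab hac
  rw [compl_adj] at hab hac
  by_contra hbc
  by_cases h : G.Adj b c
  · exact hM (mem_M hF hG hbc hab.1.symm hac.1.symm h (fun h => hab.2 h.symm)
      (fun h => hac.2 h.symm))
  · exact hS (mem_S3 hF hG hab.1 hac.1 hbc hab.2 hac.2 h)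

lemma no_compl_P4 (hF : F.Hereditary) (h4 : ¬ F _ gP4) (hG : F V G) {a b c d : V}
    (hab : Gᶜ.Adj a b) (hbc : Gᶜ.Adj b c) (hcd : Gᶜ.Adj c d)
    (hac : ¬ Gᶜ.Adj a c) (had : ¬ Gᶜ.Adj a d) (hbd : ¬ Gᶜ.Adj b d)
    (nac : a ≠ c) (nad : a ≠ d) (nbd : b ≠ d) : False := by
  simp only [compl_adj, not_and, not_not] at *
  have hca := (hac nac).symm
  have hda := (had nad).symm
  have hbd := hbd nbd
  have hcb : ¬ G.Adj c b := fun h => hbc.2 h.symm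
  have hba : ¬ G.Adj b a := fun h => hab.2 h.symm
  have hdc : ¬ G.Adj d c := fun h => hcd.2 h.symm
  exact h4 (quad hF _ hG b d a c nbd hab.1.symm nad.symm hbc.1 hcd.1.symm nac
    (by simp only [hbd, true_iff]; decide)
    (by simp only [hba, false_iff]; decide)
    (by simp only [hda, true_iff]; decide)
    (by simp only [hbc.2, false_iff]; decide)
    (by simp only [hdc, false_iff]; decide)
    (by simp only [hac nac, true_iff]; decide))

lemma no_compl_paw (hF : F.Hereditary) (h4 : ¬ F _ gPK) (hG : F V G) {u v w z : V}
    (huv : Gᶜ.Adj u v) (huw : Gᶜ.Adj u w) (hvw : Gᶜ.Adj v w) (hwz : Gᶜ.Adj w z)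
    (huz : ¬ Gᶜ.Adj u z) (hvz : ¬ Gᶜ.Adj v z)
    (nuz : u ≠ z) (nvz : v ≠ z) : False := by
  simp only [compl_adj, not_and, not_not] at *
  have hzv := (hvz nvz).symm
  have hzw : ¬ G.Adj z w := fun h => hwz.2 h.symm
  exact h4 (quad hF _ hG u z v w nuz huv.1 nvz.symm huw.1 hwz.1.symm hvw.1
    (by simp only [huz nuz, true_iff]; decide)
    (by simp only [huv.2, false_iff]; decide)
    (by simp only [hzv, true_iff]; decide)
    (by simp only [huw.2, false_iff]; decide)
    (by simp only [hzw, false_iff]; decide)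
    (by simp only [hvw.2, false_iff]; decide))

lemma no_compl_C4 (hF : F.Hereditary) (h4 : ¬ F _ gKK) (hG : F V G) {a b x y : V}
    (hab : Gᶜ.Adj a b) (hbx : Gᶜ.Adj b x) (hxy : Gᶜ.Adj x y) (hya : Gᶜ.Adj y a)
    (hax : ¬ Gᶜ.Adj a x) (hby : ¬ Gᶜ.Adj b y)
    (nax : a ≠ x) (nby : b ≠ y) : False := by
  simp only [compl_adj, not_and, not_not] at *
  have hxb : ¬ G.Adj x b := fun h => hbx.2 h.symm
  have hay : ¬ G.Adj a y := fun h => hya.2 h.symm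
  exact h4 (quad hF _ hG a x b y nax hab.1 hbx.1.symm hya.1.symm hxy.1 nby
    (by simp only [hax nax, true_iff]; decide)
    (by simp only [hab.2, false_iff]; decide)
    (by simp only [hxb, false_iff]; decide)
    (by simp only [hay, false_iff]; decide)
    (by simp only [hxy.2, false_iff]; decide)
    (by simp only [hby nby, true_iff]; decide))

lemma comps (hF : F.Hereditary) (h4 : ¬ F _ gP4) (hPK : ¬ F _ gPK) (hKK : ¬ F _ gKK)
    (hG : F V G) : ComponentsCliqueJoinStable Gᶜ := by
  have n4 := @no_compl_P4 F V _ G hF h4 hG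
  have nP := @no_compl_paw F V _ G hF hPK hG
  have nC := @no_compl_C4 F V _ G hF hKK hG
  generalize Gᶜ = H at *
  have key : ∀ u v w : V, H.Adj u v → H.Reachable u w → w = u ∨ w = v ∨ H.Adj u w ∨ H.Adj v w := by
    intro u v w huv hw
    rw [reachable_iff_reflTransGen] at hw
    induction hw with
    | refl => exact Or.inl rfl
    | @tail w z _ hwz ih =>
      rcases ih with rfl | rfl | ih
      · exact Or.inr (Or.inr (Or.inl hwz))
      · exact Or.inr (Or.inr (Or.inr hwz))
      · by_contra hcon
        push Not at hcon
        obtain ⟨h1, h2, h3, h5⟩ := hcon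
        by_cases hu : H.Adj u w <;> by_cases hv : H.Adj v w
        · exact nP huv hu hv hwz h3 h5 (Ne.symm h1) (Ne.symm h2)
        · exact n4 huv.symm hu hwz hv h5 h3 (by rintro rfl; exact h5 hwz) (Ne.symm h2) (Ne.symm h1)
        · exact n4 huv hv hwz hu h3 h5 (by rintro rfl; exact h3 hwz) (Ne.symm h1) (Ne.symm h2)
        · tauto
  intro c
  have reach : ∀ a b : c.supp, H.Reachable a b := by
    intro a b
    exact ConnectedComponent.exact (a.2.trans b.2.symm)
  refine ⟨{a | ∀ b : c.supp, a ≠ b → (H.induce c.supp).Adj a b}, ?_, ?_, ?_⟩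
  · intro a ha b _ hab
    exact ha b hab
  · intro a ha b hb hab
    simp only [Set.mem_ofPred_eq, not_forall, comap_adj, Function.Embedding.subtype_apply]
      at ha hb hab
    obtain ⟨x, nax, hax⟩ := ha
    obtain ⟨y, nby, hby⟩ := hb
    have nax' : (a : V) ≠ x := fun h => nax (Subtype.ext h)
    have nby' : (b : V) ≠ y := fun h => nby (Subtype.ext h)
    have hbx : H.Adj b x := by
      rcases key a b x hab (reach a x) with h | h | h | h
      · exact (nax' h.symm).elim
      · rw [h] at hax; exact (hax hab).elim
      · exact (hax h).elim
      · exact h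
    have hay : H.Adj a y := by
      rcases key a b y hab (reach a y) with h | h | h | h
      · rw [h] at hby; exact (hby hab.symm).elim
      · exact (nby' h.symm).elim
      · exact h
      · exact (hby h).elim
    by_cases hxy : H.Adj x y
    · exact nC hab hbx hxy hay.symm hax hby nax' nby'
    · exact n4 hay.symm hab hbx (fun h => hby h.symm) (fun h => hxy h.symm) hax nby'.symm
        (by rintro h; rw [h] at hay; exact hax hay) nax'
  · intro a ha b hb
    exact ha b (by rintro rfl; exact hb ha)
end Recognition

/-- The propositional bookkeeping: which index plays which role. -/
lemma logic (K S2 S3 S4 P M P4 PK KK : Fin 3 → Prop)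
    (hB : ∀ i, K i ∨ (S4 i ∧ S3 i ∧ S2 i))
    (r0 : ∀ i j l : Fin 3, i ≠ j → i ≠ l → j ≠ l → S3 i → S3 j → K l → False)
    (r1 : ∀ i j l : Fin 3, i ≠ j → i ≠ l → j ≠ l → P i → P j → K l → False)
    (r2 : ∀ i j l : Fin 3, i ≠ j → i ≠ l → j ≠ l → P i → P j → S2 l → False)
    (r3 : ∀ i j l : Fin 3, i ≠ j → i ≠ l → j ≠ l → M i → M j → K l → False)
    (r4 : ∀ i j l : Fin 3, i ≠ j → i ≠ l → j ≠ l → M i → P j → K l → False)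
    (r5 : ∀ i j l : Fin 3, i ≠ j → i ≠ l → j ≠ l → M i → S3 j → K l → False)
    (r6 : ∀ i j l : Fin 3, i ≠ j → i ≠ l → j ≠ l → P4 i → K j → K l → False)
    (r7 : ∀ i j l : Fin 3, i ≠ j → i ≠ l → j ≠ l → PK i → K j → K l → False)
    (r8 : ∀ i j l : Fin 3, i ≠ j → i ≠ l → j ≠ l → KK i → K j → K l → False)
    (r9 : ∀ i j l : Fin 3, i ≠ j → i ≠ l → j ≠ l → S4 i → S3 j → S2 l → False)
    : (∃ i, ¬ P4 i ∧ ¬ PK i ∧ ¬ KK i ∧ ∀ j, j ≠ i → ¬ S3 j ∧ ¬ P j ∧ ¬ M j) ∨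
    (∃ i j k : Fin 3, i ≠ j ∧ i ≠ k ∧ j ≠ k ∧ ¬ P i ∧ ¬ M i ∧ ¬ S3 j ∧ ¬ P j ∧ ¬ M j ∧
      ¬ S3 k ∧ ¬ M k) := by
  have third : ∀ i j : Fin 3, i ≠ j → ∃ l, i ≠ l ∧ j ≠ l ∧ ∀ x, x = i ∨ x = j ∨ x = l := by
    decide
  by_cases hsp : ∃ i k, i ≠ k ∧ S3 i ∧ P k
  · obtain ⟨i, k, hik, hs, hp⟩ := hsp
    obtain ⟨l, hil, hkl, -⟩ := third i k hik
    have hKl : K l := by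
      rcases hB l with h | ⟨h4, h3, h2⟩
      · exact h
      rcases hB k with h | ⟨-, -, h2⟩
      · exact (r0 l i k hil.symm hkl.symm hik h3 hs h).elim
      · exact (r9 l i k hil.symm hkl.symm hik h4 hs h2).elim
    have hKk : K k := by
      rcases hB k with h | ⟨h4, h3, h2⟩
      · exact h
      exact (r0 k i l hik.symm hkl hil h3 hs hKl).elim
    refine Or.inr ⟨i, l, k, hil, hik, hkl.symm, fun h => r1 i k l hik hil hkl h hp hKl,
      fun h => r4 i k l hik hil hkl h hp hKl, fun h => r0 i l k hil hik hkl.symm hs h hKk, ?_,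
      fun h => r5 l i k hil.symm hkl.symm hik h hs hKk, fun h => r0 i k l hik hil hkl hs h hKl,
      fun h => r5 k i l hik.symm hkl hil h hs hKl⟩
    intro h
    rcases hB i with hi | ⟨-, -, hi⟩
    · exact r1 l k i hkl.symm hil.symm hik.symm h hp hi
    · exact r2 l k i hkl.symm hil.symm hik.symm h hp hi
  · have hsp' : ∀ i k, i ≠ k → S3 i → P k → False := fun i k h1 h2 h3 => hsp ⟨i, k, h1, h2, h3⟩
    have uniq : ∀ i j, i ≠ j → (S3 i ∨ P i ∨ M i) → (S3 j ∨ P j ∨ M j) → False := by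
      intro i j hij hi hj
      obtain ⟨l, hil, hjl, -⟩ := third i j hij
      rcases hB l with h | ⟨h4, h3, h2⟩
      · rcases hi with hi | hi | hi <;> rcases hj with hj | hj | hj
        · exact r0 i j l hij hil hjl hi hj h
        · exact hsp' i j hij hi hj
        · exact r5 j i l hij.symm hjl hil hj hi h
        · exact hsp' j i hij.symm hj hi
        · exact r1 i j l hij hil hjl hi hj h
        · exact r4 j i l hij.symm hjl hil hj hi h
        · exact r5 i j l hij hil hjl hi hj h
        · exact r4 i j l hij hil hjl hi hj h
        · exact r3 i j l hij hil hjl hi hj h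
      · have hKj : K j → False := by
          intro hK
          rcases hi with hi | hi | hi
          · exact r0 i l j hil hij hjl.symm hi h3 hK
          · exact hsp' l i hil.symm h3 hi
          · exact r5 i l j hil hij hjl.symm hi h3 hK
        rcases hB j with hK | ⟨j4, j3, j2⟩
        · exact hKj hK
        rcases hB i with hK | ⟨i4, i3, i2⟩
        · exact r0 j l i hjl hij.symm hil.symm j3 h3 hK
        · exact r9 j l i hjl hij.symm hil.symm j4 h3 i2
    have hex : ∃ i, ∀ j, j ≠ i → ¬ (S3 j ∨ P j ∨ M j) := by
      by_cases h : ∃ i, S3 i ∨ P i ∨ M i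
      · obtain ⟨i, hi⟩ := h
        exact ⟨i, fun j hj hN => uniq i j hj.symm hi hN⟩
      · exact ⟨0, fun j _ hN => h ⟨j, hN⟩⟩
    obtain ⟨i, hi⟩ := hex
    have hK : ∀ j, j ≠ i → K j := fun j hj =>
      (hB j).resolve_right fun h => hi j hj (Or.inl h.2.1)
    obtain ⟨j, hij⟩ : ∃ j, i ≠ j := (exists_ne i).imp fun _ h => h.symm
    obtain ⟨l, hil, hjl, -⟩ := third i j hij
    have hKj := hK j hij.symm
    have hKl := hK l hil.symm
    refine Or.inl ⟨i, fun h => r6 i j l hij hil hjl h hKj hKl,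
      fun h => r7 i j l hij hil hjl h hKj hKl, fun h => r8 i j l hij hil hjl h hKj hKl, ?_⟩
    intro x hx
    have := hi x hx
    tauto

/-- Every really canonical `C₈`-freeness witnessing `3`-sequence satisfies one of:
(1) for some index `i`, every graph in `F i` has every component of its complement a
join of a clique and a stable set, and for `j ≠ i` every graph in `F j` is complete or
the edgeless graph on two vertices; (2) for distinct `i, j, k`, every graph in `F i`
is complete or edgeless, every graph in `F j` is complete or the edgeless graph on two
vertices, and every graph in `F k` is the complement of a matching. -/
theorem stmt_7 (F : Fin 3 → GraphClass)
    (hF : IsReallyCanonicalSeq (SimpleGraph.cycleGraph 8) 3 F) :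
    (∃ i : Fin 3,
      (∀ (V : Type) [Finite V] (G : SimpleGraph V),
        F i V G → ComponentsCliqueJoinStable Gᶜ) ∧
      (∀ j : Fin 3, j ≠ i → ∀ (V : Type) [Finite V] (G : SimpleGraph V),
        F j V G → G = ⊤ ∨ (Nat.card V = 2 ∧ G = ⊥))) ∨
    (∃ i j k : Fin 3, i ≠ j ∧ i ≠ k ∧ j ≠ k ∧
      (∀ (V : Type) [Finite V] (G : SimpleGraph V),
        F i V G → G = ⊤ ∨ G = ⊥) ∧
      (∀ (V : Type) [Finite V] (G : SimpleGraph V),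
        F j V G → G = ⊤ ∨ (Nat.card V = 2 ∧ G = ⊥)) ∧
      (∀ (V : Type) [Finite V] (G : SimpleGraph V),
        F k V G → ∀ a b c : V, Gᶜ.Adj a b → Gᶜ.Adj a c → b = c)) := by
  have hH := hF.1.1
  have hW := hF.1
  have hB : ∀ i, F i _ gK2 ∨ (F i _ gS4 ∧ F i _ gS3 ∧ F i _ gS2) := by
    intro i
    rcases (hF.2 i).2 with h | h
    · left
      have e : gK2 = ⊤ := by ext a b; revert a b; decide
      rw [e]; exact h _
    · right
      have e4 : gS4 = ⊥ := by ext a b; revert a b; decide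
      have e3 : gS3 = ⊥ := by ext a b; revert a b; decide
      have e2 : gS2 = ⊥ := by ext a b; revert a b; decide
      rw [e4, e3, e2]; exact ⟨h _, h _, h _⟩
  have main := logic (fun i => F i _ gK2) (fun i => F i _ gS2) (fun i => F i _ gS3)
    (fun i => F i _ gS4) (fun i => F i _ gP3) (fun i => F i _ gM)
    (fun i => F i _ gP4) (fun i => F i _ gPK) (fun i => F i _ gKK) hB
    (fun _ _ _ => f_SSK hW) (fun _ _ _ => f_PPK hW) (fun _ _ _ => f_PPS hW)
    (fun _ _ _ => f_MMK hW) (fun _ _ _ => f_MPK hW) (fun _ _ _ => f_MSK hW)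
    (fun _ _ _ => f_P4 hW) (fun _ _ _ => f_PK hW) (fun _ _ _ => f_KK hW)
    (fun _ _ _ => f_SSS hW)
  rcases main with ⟨i, h1, h2, h3, h4⟩ | ⟨i, j, k, hij, hik, hjk, h1, h2, h3, h4, h5, h6, h7⟩
  · exact Or.inl ⟨i, fun V _ G hG => comps (hH i) h1 h2 h3 hG, fun j hj V _ G hG =>
      top_or_two (hH j) (h4 j hj).1 (h4 j hj).2.1 (h4 j hj).2.2 hG⟩
  · exact Or.inr ⟨i, j, k, hij, hik, hjk, fun V _ G hG => top_or_bot (hH i) h1 h2 hG,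
      fun V _ G hG => top_or_two (hH j) h3 h4 h5 hG,
      fun V _ G hG => compl_matching (hH k) h6 h7 hG⟩
end

section
/- Let l > 5 be an integer and let C_{2l} be the cycle on 2l vertices. Then: (a) for all graphs L and M, each belonging to {P_3, complement of P_3, E_3}, and all nonnegative integers a, b with a + b = l − 3, the vertex set of C_{2l} can be partitioned into parts inducing, respectively, a copy of L, a copy of M, a parts each inducing a single edge (K_2), and b parts each inducing an edgeless pair (E_2); (b) for all nonnegative a, b with a + b = l − 2, the vertex set of C_{2l} can be partitioned into a part inducing P_4, a parts inducing K_2, and b parts inducing E_2; (c) for every graph J with 4 vertices and at most 2 edges and all nonnegative a, b with a + b = l − 2, the vertex set of C_{2l} can be partitioned into a part inducing a copy of J, a parts inducing K_2, and b parts inducing E_2. -/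
open SimpleGraph

/-- Graph on `Fin s` whose adjacency is that the labels differ by one. -/
def labGraph {s : ℕ} (q : Fin s → ℕ) : SimpleGraph (Fin s) where
  Adj i j := q i + 1 = q j ∨ q j + 1 = q i
  symm := ⟨fun _ _ h => h.symm⟩
  loopless := ⟨fun _ h => by omega⟩

theorem cyc_adj {n : ℕ} (hn : 3 ≤ n) (u v : Fin n) :
    (cycleGraph n).Adj u v ↔ (u.val + 1 = v.val ∨ v.val + 1 = u.val ∨
      (u.val = 0 ∧ v.val + 1 = n) ∨ (v.val = 0 ∧ u.val + 1 = n)) := by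
  rw [cycleGraph_adj']
  have hu := u.isLt
  have hv := v.isLt
  rw [Fin.sub_def, Fin.sub_def]
  dsimp only
  have key : ∀ x y : ℕ, x < n → y < n → ((n - y + x) % n = 1 ↔ (y + 1 = x ∨ (x = 0 ∧ y + 1 = n))) := by
    intro x y hx hy
    by_cases h : y ≤ x
    · rw [show n - y + x = (x - y) + n by omega, Nat.add_mod_right, Nat.mod_eq_of_lt (by omega)]
      omega
    · rw [Nat.mod_eq_of_lt (by omega)]
      omega
  rw [key _ _ hu hv, key _ _ hv hu]
  omega

/-- Isomorphism of a fibre of the labelling. -/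
theorem fibre_iso {V I T : Type*} (G : SimpleGraph V) (e : I ≃ V) (lab : I → T) (x : T)
    {k : ℕ} (H : SimpleGraph (Fin k)) (g : Fin k → I) (hg : Function.Injective g)
    (hl : ∀ c, lab c = x ↔ ∃ i, g i = c)
    (hadj : ∀ i j, G.Adj (e (g i)) (e (g j)) ↔ H.Adj i j) :
    Nonempty (G.induce {v | lab (e.symm v) = x} ≃g H) := by
  have hm : ∀ i, e (g i) ∈ {v | lab (e.symm v) = x} := by
    intro i
    simp only [Set.mem_ofPred_eq, Equiv.symm_apply_apply]
    exact (hl _).2 ⟨i, rfl⟩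
  let F : Fin k → {v | lab (e.symm v) = x} := fun i => ⟨e (g i), hm i⟩
  have hF : Function.Bijective F := by
    constructor
    · intro i j h
      exact hg (e.injective (congrArg Subtype.val h))
    · rintro ⟨v, hv⟩
      obtain ⟨i, hi⟩ := (hl _).1 hv
      refine ⟨i, Subtype.ext ?_⟩
      simp [F, hi]
  refine ⟨RelIso.symm ⟨Equiv.ofBijective F hF, ?_⟩⟩
  intro i j
  exact hadj i j

/-- The decidable data required of a pattern: special vertices `q`, then the first six of
the remaining vertices `W`. -/
def Good {P : Type} (s m : ℕ) (q : P → Fin s → ℕ) (W : Fin 6 → ℕ) : Prop :=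
  (∀ p i, q p i < m + 6 ∧ q p i < 10) ∧
  (∀ p i p' i', q p i = q p' i' → p = p' ∧ i = i') ∧
  (∀ x p i, W x ≠ q p i) ∧
  (W 0 < W 1 ∧ W 1 < W 2 ∧ W 2 < W 3 ∧ W 3 < W 4 ∧ W 4 < W 5 ∧ W 5 < m + 6) ∧
  W 3 = W 2 + 1 ∧ W 5 = W 4 + 1

instance {P : Type} [Fintype P] [DecidableEq P] (s m : ℕ) (q : P → Fin s → ℕ) (W : Fin 6 → ℕ) :
    Decidable (Good s m q W) := by unfold Good; infer_instance

/-- The enumeration of the remaining vertices. -/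
def rest (m : ℕ) (W : Fin 6 → ℕ) (i : ℕ) : ℕ := if h : i < 6 then W ⟨i, h⟩ else i + m

theorem rest_mono (m : ℕ) (W : Fin 6 → ℕ)
    (h : W 0 < W 1 ∧ W 1 < W 2 ∧ W 2 < W 3 ∧ W 3 < W 4 ∧ W 4 < W 5 ∧ W 5 < m + 6) :
    StrictMono (rest m W) := by
  apply strictMono_nat_of_lt_succ
  intro i
  obtain ⟨h0, h1, h2, h3, h4, h5⟩ := h
  by_cases hi : i < 6
  · interval_cases i <;> simp [rest] <;> first | assumption | omega
  · have h' : ¬ i + 1 < 6 := by omega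
    simp only [rest, hi, h', dif_neg, not_false_eq_true]
    omega

theorem rest_pair (m : ℕ) (W : Fin 6 → ℕ) (h3 : W 3 = W 2 + 1) (h5 : W 5 = W 4 + 1)
    (i : ℕ) (hi : 1 ≤ i ∨ W 1 = W 0 + 1) : rest m W (2 * i + 1) = rest m W (2 * i) + 1 := by
  by_cases h : i < 3
  · interval_cases i
    · simpa [rest] using hi
    · simpa [rest] using h3
    · simpa [rest] using h5
  · have h1 : ¬ 2 * i < 6 := by omega
    have h2 : ¬ 2 * i + 1 < 6 := by omega
    simp only [rest, h1, h2, dif_neg, not_false_eq_true]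
    omega

/-- Position in the enumeration `rest`. -/
def pos (a b : ℕ) : (Fin a × Fin 2) ⊕ (Fin b × Fin 2) → ℕ
  | Sum.inl (i, j) => 2 * b + 2 * i.val + j.val
  | Sum.inr (i, j) => if j = 0 then i.val else i.val + b

theorem pos_lt (a b : ℕ) (x) : pos a b x < 2 * (a + b) := by
  rcases x with ⟨i, j⟩ | ⟨i, j⟩
  · simp only [pos]; omega
  · simp only [pos]; split_ifs <;> omega

theorem pos_inj (a b : ℕ) : Function.Injective (pos a b) := by
  rintro (⟨i, j⟩ | ⟨i, j⟩) (⟨i', j'⟩ | ⟨i', j'⟩) h <;> simp only [pos] at h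
  · have h1 : i = i' := by omega
    have h2 : j = j' := by omega
    rw [h1, h2]
  · split_ifs at h <;> omega
  · split_ifs at h <;> omega
  · split_ifs at h
    · have h1 : i = i' := by omega
      have h2 : j = j' := by omega
      rw [h1, h2]
    · omega
    · omega
    · have h1 : i = i' := by omega
      have h2 : j = j' := by omega
      rw [h1, h2]

theorem core {P : Type} [Fintype P] [DecidableEq P] (s m n a b : ℕ)
    (hm : Fintype.card P * s = m) (hn : n = m + 2 * (a + b)) (hk : 3 ≤ a + b) (hn12 : 12 ≤ n)
    (q : P → Fin s → ℕ) (W : Fin 6 → ℕ) (hG : Good s m q W)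
    (hb : b = 0 ∧ W 1 = W 0 + 1 ∨ 0 < b ∧ W 1 ≠ W 0 + 1) :
    ∃ t : Fin n → P ⊕ (Fin a ⊕ Fin b),
      (∀ p, Nonempty ((cycleGraph n).induce {v | t v = Sum.inl p} ≃g labGraph (q p))) ∧
      (∀ i : Fin a, Nonempty ((cycleGraph n).induce
            {v | t v = Sum.inr (Sum.inl i)} ≃g (⊤ : SimpleGraph (Fin 2)))) ∧
      (∀ j : Fin b, Nonempty ((cycleGraph n).induce
            {v | t v = Sum.inr (Sum.inr j)} ≃g (⊥ : SimpleGraph (Fin 2)))) := by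
  obtain ⟨hq, hqi, hWq, hW, h3, h5⟩ := hG
  have hmono := rest_mono m W hW
  have hrn : ∀ i, i < 2 * (a + b) → rest m W i < n := by
    intro i hi
    by_cases h : i < 6
    · have : rest m W i < rest m W 6 := hmono h
      have h6 : rest m W 6 = 6 + m := by simp [rest]
      omega
    · simp only [rest, h, dif_neg, not_false_eq_true]; omega
  have hrq : ∀ i p j, rest m W i ≠ q p j := by
    intro i p j
    by_cases h : i < 6
    · simp only [rest, h, dif_pos]; exact hWq _ _ _
    · have := (hq p j).1
      simp only [rest, h, dif_neg, not_false_eq_true]; omega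
  let f : (P × Fin s) ⊕ ((Fin a × Fin 2) ⊕ (Fin b × Fin 2)) → Fin n := fun c =>
    match c with
    | Sum.inl (p, i) => ⟨q p i, by have := (hq p i).2; omega⟩
    | Sum.inr x => ⟨rest m W (pos a b x), hrn _ (pos_lt a b x)⟩
  have hfi : Function.Injective f := by
    rintro (⟨p, i⟩ | x) (⟨p', i'⟩ | y) h <;> simp only [f, Fin.mk.injEq] at h
    · obtain ⟨h1, h2⟩ := hqi _ _ _ _ h
      rw [h1, h2]
    · exact absurd h.symm (hrq _ _ _)
    · exact absurd h (hrq _ _ _)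
    · rw [pos_inj a b (hmono.injective h)]
  have hfb : Function.Bijective f := by
    rw [Fintype.bijective_iff_injective_and_card]
    refine ⟨hfi, ?_⟩
    simp only [Fintype.card_sum, Fintype.card_prod, Fintype.card_fin]
    omega
  let e := Equiv.ofBijective f hfb
  let lab : (P × Fin s) ⊕ ((Fin a × Fin 2) ⊕ (Fin b × Fin 2)) → P ⊕ (Fin a ⊕ Fin b) :=
    Sum.map Prod.fst (Sum.map Prod.fst Prod.fst)
  refine ⟨fun v => lab (e.symm v), ?_, ?_, ?_⟩
  · intro p
    refine fibre_iso _ e lab _ _ (fun i => Sum.inl (p, i)) ?_ ?_ ?_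
    · intro i j h; simpa using h
    · rintro (⟨p', i⟩ | ⟨i, j⟩ | ⟨i, j⟩) <;> simp [lab, eq_comm]
    · intro i j
      rw [cyc_adj (by omega)]
      have h1 := (hq p i).2
      have h2 := (hq p j).2
      simp only [e, f, Equiv.ofBijective_apply, labGraph]
      omega
  · intro i
    refine fibre_iso _ e lab _ _ (fun j => Sum.inr (Sum.inl (i, j))) ?_ ?_ ?_
    · intro i j h; simpa using h
    · rintro (⟨p', i⟩ | ⟨i, j⟩ | ⟨i, j⟩) <;> simp [lab, eq_comm]
    · have hp := rest_pair m W h3 h5 (b + i.val) (by omega)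
      have hadj : (cycleGraph n).Adj (e (Sum.inr (Sum.inl (i, 0)))) (e (Sum.inr (Sum.inl (i, 1)))) := by
        rw [cyc_adj (by omega)]
        left
        simp only [e, f, Equiv.ofBijective_apply, pos]
        rw [mul_add] at hp
        simpa using hp.symm
      intro j j'
      fin_cases j <;> fin_cases j' <;> simp [hadj, hadj.symm]
  · intro i
    refine fibre_iso _ e lab _ _ (fun j => Sum.inr (Sum.inr (i, j))) ?_ ?_ ?_
    · intro i j h; simpa using h
    · rintro (⟨p', i⟩ | ⟨i, j⟩ | ⟨i, j⟩) <;> simp [lab, eq_comm]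
    · have hi := i.isLt
      have hlt : rest m W i.val < rest m W (i.val + b) := hmono (by omega)
      have hne : rest m W (i.val + b) ≠ rest m W i.val + 1 := by
        by_cases hb1 : b = 1
        · subst hb1
          have : i.val = 0 := by omega
          rw [this]
          have := hb.resolve_left (by omega)
          simpa [rest] using this.2
        · have h1 : rest m W i.val < rest m W (i.val + 1) := hmono (by omega)
          have h2 : rest m W (i.val + 1) < rest m W (i.val + b) := hmono (by omega)
          omega
      have hlast : rest m W i.val ≠ 0 ∨ rest m W (i.val + b) + 1 < n := by
        by_cases hi0 : i.val = 0
        · right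
          have h1 : rest m W (i.val + b) < rest m W (2 * (a + b) - 1) := hmono (by omega)
          have := hrn (2 * (a + b) - 1) (by omega)
          omega
        · left
          have h1 : rest m W 0 < rest m W i.val := hmono (by omega)
          omega
      have hadj : ¬ (cycleGraph n).Adj (e (Sum.inr (Sum.inr (i, 0)))) (e (Sum.inr (Sum.inr (i, 1)))) := by
        rw [cyc_adj (by omega)]
        simp only [e, f, Equiv.ofBijective_apply, pos]
        simp
        omega
      have hadj' : ¬ (cycleGraph n).Adj (e (Sum.inr (Sum.inr (i, 1)))) (e (Sum.inr (Sum.inr (i, 0)))) :=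
        fun h => hadj (SimpleGraph.Adj.symm h)
      intro j j'
      fin_cases j <;> fin_cases j' <;> simp [hadj, hadj']

/-- Both regimes (`b = 0` and `b > 0`) at once. -/
theorem core2 {P : Type} [Fintype P] [DecidableEq P] (s m n a b : ℕ)
    (hm : Fintype.card P * s = m) (hn : n = m + 2 * (a + b)) (hk : 3 ≤ a + b) (hn12 : 12 ≤ n)
    (H : P → SimpleGraph (Fin s))
    (q : P → Fin s → ℕ) (W : Fin 6 → ℕ) (hG : Good s m q W ∧ W 1 = W 0 + 1)
    (q' : P → Fin s → ℕ) (W' : Fin 6 → ℕ) (hG' : Good s m q' W' ∧ W' 1 ≠ W' 0 + 1)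
    (hH : ∀ p, labGraph (q p) = H p) (hH' : ∀ p, labGraph (q' p) = H p) :
    ∃ t : Fin n → P ⊕ (Fin a ⊕ Fin b),
      (∀ p, Nonempty ((cycleGraph n).induce {v | t v = Sum.inl p} ≃g H p)) ∧
      (∀ i : Fin a, Nonempty ((cycleGraph n).induce
            {v | t v = Sum.inr (Sum.inl i)} ≃g (⊤ : SimpleGraph (Fin 2)))) ∧
      (∀ j : Fin b, Nonempty ((cycleGraph n).induce
            {v | t v = Sum.inr (Sum.inr j)} ≃g (⊥ : SimpleGraph (Fin 2)))) := by
  rcases Nat.eq_zero_or_pos b with hb | hb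
  · obtain ⟨t, h1, h2⟩ := core s m n a b hm hn hk hn12 q W hG.1 (Or.inl ⟨hb, hG.2⟩)
    exact ⟨t, fun p => hH p ▸ h1 p, h2⟩
  · obtain ⟨t, h1, h2⟩ := core s m n a b hm hn hk hn12 q' W' hG'.1 (Or.inr ⟨hb, hG'.2⟩)
    exact ⟨t, fun p => hH' p ▸ h1 p, h2⟩

theorem lab_path3 (q : Fin 3 → ℕ) (h : q 1 = q 0 + 1 ∧ q 2 = q 1 + 1) :
    labGraph q = pathGraph 3 := by
  ext i j
  rw [pathGraph_adj]
  fin_cases i <;> fin_cases j <;> simp [labGraph] <;> omega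

theorem lab_copath3 (q : Fin 3 → ℕ) (h : q 2 = q 0 + 1 ∧ (q 1 + 1 < q 0 ∨ q 2 + 1 < q 1)) :
    labGraph q = (pathGraph 3)ᶜ := by
  ext i j
  rw [compl_adj, pathGraph_adj]
  fin_cases i <;> fin_cases j <;> simp [labGraph] <;> omega

theorem lab_bot3 (q : Fin 3 → ℕ) (h : q 0 + 1 < q 1 ∧ q 1 + 1 < q 2) :
    labGraph q = ⊥ := by
  ext i j
  fin_cases i <;> fin_cases j <;> simp [labGraph] <;> omega

theorem lab_path4 (q : Fin 4 → ℕ) (h : q 1 = q 0 + 1 ∧ q 2 = q 1 + 1 ∧ q 3 = q 2 + 1) :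
    labGraph q = pathGraph 4 := by
  ext i j
  rw [pathGraph_adj]
  fin_cases i <;> fin_cases j <;> simp [labGraph] <;> omega

/-- Adjacency from six bits. -/
def bitAdj (x01 x02 x03 x12 x13 x23 : Bool) : Fin 4 → Fin 4 → Bool :=
  ![![false, x01, x02, x03], ![x01, false, x12, x13], ![x02, x12, false, x23],
    ![x03, x13, x23, false]]

/-- The four graphs on four vertices with at most two edges, as labels. -/
def stdLab : Fin 4 → Fin 4 → ℕ :=
  ![![0, 3, 6, 9], ![0, 1, 4, 7], ![0, 1, 4, 5], ![0, 1, 2, 5]]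

theorem bits_classify : ∀ x01 x02 x03 x12 x13 x23 : Bool,
    x01.toNat + x02.toNat + x03.toNat + x12.toNat + x13.toNat + x23.toNat ≤ 2 →
    ∃ c : Fin 4, ∃ w : Fin 4 → Fin 4, (∀ i j, w i = w j → i = j) ∧ ∀ i j,
      bitAdj x01 x02 x03 x12 x13 x23 (w i) (w j) =
        decide (stdLab c i + 1 = stdLab c j ∨ stdLab c j + 1 = stdLab c i) := by
  decide +kernel

theorem classify (J : SimpleGraph (Fin 4)) (hJ : J.edgeSet.ncard ≤ 2) :
    ∃ c : Fin 4, Nonempty (labGraph (stdLab c) ≃g J) := by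
  classical
  have hsum := J.sum_degrees_eq_twice_card_edges
  rw [← Set.ncard_coe_finset, coe_edgeFinset] at hsum
  have hd : ∀ v, J.degree v = ∑ w, (decide (J.Adj v w)).toNat := by
    intro v
    rw [← card_neighborFinset_eq_degree, neighborFinset_eq_filter, Finset.card_filter]
    refine Finset.sum_congr rfl fun w _ => ?_
    by_cases h : J.Adj v w <;> simp [h]
  simp only [hd, Fin.sum_univ_four] at hsum
  simp only [J.adj_comm 1 0, J.adj_comm 2 0, J.adj_comm 3 0, J.adj_comm 2 1, J.adj_comm 3 1,
    J.adj_comm 3 2, SimpleGraph.irrefl, decide_false, Bool.toNat_false] at hsum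
  obtain ⟨c, w, hw, h⟩ := bits_classify (decide (J.Adj 0 1)) (decide (J.Adj 0 2))
    (decide (J.Adj 0 3)) (decide (J.Adj 1 2)) (decide (J.Adj 1 3)) (decide (J.Adj 2 3)) (by omega)
  have hbit : ∀ i j, bitAdj (decide (J.Adj 0 1)) (decide (J.Adj 0 2))
    (decide (J.Adj 0 3)) (decide (J.Adj 1 2)) (decide (J.Adj 1 3)) (decide (J.Adj 2 3)) i j
      = decide (J.Adj i j) := by
    intro i j
    fin_cases i <;> fin_cases j <;> simp [bitAdj, J.adj_comm 1 0, J.adj_comm 2 0, J.adj_comm 3 0,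
      J.adj_comm 2 1, J.adj_comm 3 1, J.adj_comm 3 2]
  have hwi : Function.Injective w := fun i j => hw i j
  refine ⟨c, ⟨⟨Equiv.ofBijective w (Finite.injective_iff_bijective.1 hwi), ?_⟩⟩⟩
  intro i j
  have := h i j
  rw [hbit, decide_eq_decide] at this
  exact this

/-- Labels of the alternative pattern (used when `b > 0`). -/
def stdLab' : Fin 4 → Fin 4 → ℕ :=
  ![![0, 2, 4, 7], ![0, 1, 3, 5], ![0, 1, 3, 4], ![0, 1, 2, 4]]

def stdW : Fin 4 → Fin 6 → ℕ :=
  ![![1, 2, 4, 5, 7, 8], ![2, 3, 5, 6, 8, 9], ![2, 3, 6, 7, 8, 9], ![3, 4, 6, 7, 8, 9]]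

def stdW' : Fin 4 → Fin 6 → ℕ :=
  ![![1, 3, 5, 6, 8, 9], ![2, 4, 6, 7, 8, 9], ![2, 5, 6, 7, 8, 9], ![3, 5, 6, 7, 8, 9]]

theorem std_good : ∀ c, (Good (P := Unit) 4 4 (fun _ => stdLab c) (stdW c) ∧
    stdW c 1 = stdW c 0 + 1) ∧ (Good (P := Unit) 4 4 (fun _ => stdLab' c) (stdW' c) ∧
    stdW' c 1 ≠ stdW' c 0 + 1) := by decide

theorem std_same (c : Fin 4) : labGraph (stdLab' c) = labGraph (stdLab c) := by
  have h : ∀ c i j : Fin 4, (stdLab' c i + 1 = stdLab' c j ∨ stdLab' c j + 1 = stdLab' c i) ↔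
    (stdLab c i + 1 = stdLab c j ∨ stdLab c j + 1 = stdLab c i) := by decide
  ext i j
  exact h c i j

theorem part_a {n a b : ℕ} (hn : n = 6 + 2 * (a + b)) (hk : 3 ≤ a + b)
    (L M : SimpleGraph (Fin 3)) (q q' : Fin 2 → Fin 3 → ℕ) (W W' : Fin 6 → ℕ)
    (hG : Good 3 6 q W ∧ W 1 = W 0 + 1) (hG' : Good 3 6 q' W' ∧ W' 1 ≠ W' 0 + 1)
    (h0 : labGraph (q 0) = L) (h1 : labGraph (q 1) = M)
    (h0' : labGraph (q' 0) = L) (h1' : labGraph (q' 1) = M) :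
    ∃ t : Fin n → (Fin 2 ⊕ (Fin a ⊕ Fin b)),
          Nonempty ((cycleGraph n).induce {v | t v = Sum.inl 0} ≃g L) ∧
          Nonempty ((cycleGraph n).induce {v | t v = Sum.inl 1} ≃g M) ∧
          (∀ i : Fin a, Nonempty ((cycleGraph n).induce
            {v | t v = Sum.inr (Sum.inl i)} ≃g (⊤ : SimpleGraph (Fin 2)))) ∧
          (∀ j : Fin b, Nonempty ((cycleGraph n).induce
            {v | t v = Sum.inr (Sum.inr j)} ≃g (⊥ : SimpleGraph (Fin 2)))) := by
  obtain ⟨t, ht, h2⟩ := core2 3 6 n a b (by simp) hn hk (by omega) ![L, M] q W hG q' W' hG'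
    (by intro p; fin_cases p <;> simpa) (by intro p; fin_cases p <;> simpa)
  exact ⟨t, ht 0, ht 1, h2⟩

theorem stmt_8 (l : ℕ) (hl : 5 < l) :
    (∀ L M : SimpleGraph (Fin 3),
      (L = pathGraph 3 ∨ L = (pathGraph 3)ᶜ ∨ L = ⊥) →
      (M = pathGraph 3 ∨ M = (pathGraph 3)ᶜ ∨ M = ⊥) →
      ∀ a b : ℕ, a + b = l - 3 →
        ∃ t : Fin (2 * l) → (Fin 2 ⊕ (Fin a ⊕ Fin b)),
          Nonempty ((cycleGraph (2 * l)).induce {v | t v = Sum.inl 0} ≃g L) ∧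
          Nonempty ((cycleGraph (2 * l)).induce {v | t v = Sum.inl 1} ≃g M) ∧
          (∀ i : Fin a, Nonempty ((cycleGraph (2 * l)).induce
            {v | t v = Sum.inr (Sum.inl i)} ≃g (⊤ : SimpleGraph (Fin 2)))) ∧
          (∀ j : Fin b, Nonempty ((cycleGraph (2 * l)).induce
            {v | t v = Sum.inr (Sum.inr j)} ≃g (⊥ : SimpleGraph (Fin 2))))) ∧
    (∀ a b : ℕ, a + b = l - 2 →
      ∃ t : Fin (2 * l) → (Unit ⊕ (Fin a ⊕ Fin b)),
        Nonempty ((cycleGraph (2 * l)).induce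
          {v | t v = Sum.inl ()} ≃g pathGraph 4) ∧
        (∀ i : Fin a, Nonempty ((cycleGraph (2 * l)).induce
          {v | t v = Sum.inr (Sum.inl i)} ≃g (⊤ : SimpleGraph (Fin 2)))) ∧
        (∀ j : Fin b, Nonempty ((cycleGraph (2 * l)).induce
          {v | t v = Sum.inr (Sum.inr j)} ≃g (⊥ : SimpleGraph (Fin 2))))) ∧
    (∀ J : SimpleGraph (Fin 4), J.edgeSet.ncard ≤ 2 →
      ∀ a b : ℕ, a + b = l - 2 →
        ∃ t : Fin (2 * l) → (Unit ⊕ (Fin a ⊕ Fin b)),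
          Nonempty ((cycleGraph (2 * l)).induce {v | t v = Sum.inl ()} ≃g J) ∧
          (∀ i : Fin a, Nonempty ((cycleGraph (2 * l)).induce
            {v | t v = Sum.inr (Sum.inl i)} ≃g (⊤ : SimpleGraph (Fin 2)))) ∧
          (∀ j : Fin b, Nonempty ((cycleGraph (2 * l)).induce
            {v | t v = Sum.inr (Sum.inr j)} ≃g (⊥ : SimpleGraph (Fin 2))))) := by
  refine ⟨?_, ?_, ?_⟩
  · intro L M hL hM a b hab
    have hn : 2 * l = 6 + 2 * (a + b) := by omega
    have hk : 3 ≤ a + b := by omega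
    rcases hL with rfl | rfl | rfl <;> rcases hM with rfl | rfl | rfl
    · exact part_a hn hk _ _ ![![0, 1, 2], ![3, 4, 5]] ![![1, 2, 3], ![4, 5, 6]]
        ![6, 7, 8, 9, 10, 11] ![0, 7, 8, 9, 10, 11] (by decide) (by decide)
        (lab_path3 _ (by decide)) (lab_path3 _ (by decide))
        (lab_path3 _ (by decide)) (lab_path3 _ (by decide))
    · exact part_a hn hk _ _ ![![1, 2, 3], ![4, 0, 5]] ![![2, 3, 4], ![5, 1, 6]]
        ![6, 7, 8, 9, 10, 11] ![0, 7, 8, 9, 10, 11] (by decide) (by decide)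
        (lab_path3 _ (by decide)) (lab_copath3 _ (by decide))
        (lab_path3 _ (by decide)) (lab_copath3 _ (by decide))
    · exact part_a hn hk _ _ ![![1, 2, 3], ![0, 4, 7]] ![![1, 2, 3], ![0, 4, 6]]
        ![5, 6, 8, 9, 10, 11] ![5, 7, 8, 9, 10, 11] (by decide) (by decide)
        (lab_path3 _ (by decide)) (lab_bot3 _ (by decide))
        (lab_path3 _ (by decide)) (lab_bot3 _ (by decide))
    · exact part_a hn hk _ _ ![![4, 0, 5], ![1, 2, 3]] ![![5, 1, 6], ![2, 3, 4]]
        ![6, 7, 8, 9, 10, 11] ![0, 7, 8, 9, 10, 11] (by decide) (by decide)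
        (lab_copath3 _ (by decide)) (lab_path3 _ (by decide))
        (lab_copath3 _ (by decide)) (lab_path3 _ (by decide))
    · exact part_a hn hk _ _ ![![0, 3, 1], ![4, 2, 5]] ![![1, 4, 2], ![5, 3, 6]]
        ![6, 7, 8, 9, 10, 11] ![0, 7, 8, 9, 10, 11] (by decide) (by decide)
        (lab_copath3 _ (by decide)) (lab_copath3 _ (by decide))
        (lab_copath3 _ (by decide)) (lab_copath3 _ (by decide))
    · exact part_a hn hk _ _ ![![1, 4, 2], ![0, 3, 5]] ![![2, 5, 3], ![1, 4, 6]]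
        ![6, 7, 8, 9, 10, 11] ![0, 7, 8, 9, 10, 11] (by decide) (by decide)
        (lab_copath3 _ (by decide)) (lab_bot3 _ (by decide))
        (lab_copath3 _ (by decide)) (lab_bot3 _ (by decide))
    · exact part_a hn hk _ _ ![![0, 4, 7], ![1, 2, 3]] ![![0, 4, 6], ![1, 2, 3]]
        ![5, 6, 8, 9, 10, 11] ![5, 7, 8, 9, 10, 11] (by decide) (by decide)
        (lab_bot3 _ (by decide)) (lab_path3 _ (by decide))
        (lab_bot3 _ (by decide)) (lab_path3 _ (by decide))
    · exact part_a hn hk _ _ ![![0, 3, 5], ![1, 4, 2]] ![![1, 4, 6], ![2, 5, 3]]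
        ![6, 7, 8, 9, 10, 11] ![0, 7, 8, 9, 10, 11] (by decide) (by decide)
        (lab_bot3 _ (by decide)) (lab_copath3 _ (by decide))
        (lab_bot3 _ (by decide)) (lab_copath3 _ (by decide))
    · exact part_a hn hk _ _ ![![0, 2, 4], ![1, 3, 5]] ![![1, 3, 5], ![2, 4, 6]]
        ![6, 7, 8, 9, 10, 11] ![0, 7, 8, 9, 10, 11] (by decide) (by decide)
        (lab_bot3 _ (by decide)) (lab_bot3 _ (by decide))
        (lab_bot3 _ (by decide)) (lab_bot3 _ (by decide))
  · intro a b hab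
    obtain ⟨t, ht, h2⟩ := core2 (P := Unit) 4 4 (2 * l) a b (by simp) (by omega) (by omega)
      (by omega) (fun _ => pathGraph 4) (fun _ => ![0, 1, 2, 3]) ![4, 5, 6, 7, 8, 9] (by decide)
      (fun _ => ![1, 2, 3, 4]) ![0, 5, 6, 7, 8, 9] (by decide)
      (fun _ => lab_path4 _ (by decide)) (fun _ => lab_path4 _ (by decide))
    exact ⟨t, ht (), h2⟩
  · intro J hJ a b hab
    obtain ⟨c, ⟨φ⟩⟩ := classify J hJ
    obtain ⟨t, ht, h2⟩ := core2 (P := Unit) 4 4 (2 * l) a b (by simp) (by omega) (by omega)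
      (by omega) (fun _ => labGraph (stdLab c)) (fun _ => stdLab c) (stdW c) (std_good c).1
      (fun _ => stdLab' c) (stdW' c) (std_good c).2 (fun _ => rfl) (fun _ => std_same c)
    obtain ⟨ψ⟩ := ht ()
    exact ⟨t, ⟨ψ.trans φ⟩, h2⟩
end

section
/- Let G be a graph on n vertices with girth at least 5. Then the number of vertices of G whose degree exceeds (3/2)·√n is at most √n, and the sum of the degrees of the vertices whose degree exceeds (3/2)·√n is at most (3/2)·n. -/
open SimpleGraph

/-- `G` has girth at least 5: it contains no cycle of length 3 or 4. -/
def GirthAtLeastFive {V : Type*} (G : SimpleGraph V) : Prop :=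
  ∀ (v : V) (w : G.Walk v v), w.IsCycle → w.length ≠ 3 ∧ w.length ≠ 4

lemma common_le_one {V : Type*} [Fintype V] [DecidableEq V] (G : SimpleGraph V)
    [DecidableRel G.Adj] (hg : GirthAtLeastFive G) {a b : V} (hab : a ≠ b) :
    (G.neighborFinset a ∩ G.neighborFinset b).card ≤ 1 := by
  rw [Finset.card_le_one]
  intro x hx y hy
  simp only [Finset.mem_inter, mem_neighborFinset] at hx hy
  by_contra hxy
  have h1 := hx.1.ne
  have h2 := hx.2.ne
  have h3 := hy.1.ne
  have h4 := hy.2.ne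
  let w : G.Walk a a :=
    Walk.cons hx.1 (Walk.cons hx.2.symm (Walk.cons hy.2 (Walk.cons hy.1.symm Walk.nil)))
  have hw : w.IsCycle := by
    simp only [w, Walk.cons_isCycle_iff, Walk.cons_isPath_iff, Walk.IsPath.nil,
      Walk.support_cons, Walk.support_nil, Walk.edges_cons, Walk.edges_nil, List.mem_cons,
      List.not_mem_nil, Sym2.eq_iff]
    grind
  exact (hg a w hw).2 rfl

lemma sum_deg_le {V : Type*} [Fintype V] [DecidableEq V] (G : SimpleGraph V)
    [DecidableRel G.Adj] (hg : GirthAtLeastFive G) (S : Finset V) :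
    2 * ∑ v ∈ S, ((G.neighborFinset v).card : ℝ) ≤
      2 * ((S.biUnion fun v => G.neighborFinset v).card : ℝ) + S.card * (S.card - 1) := by
  induction S using Finset.induction_on with
  | empty => simp
  | insert a S ha ih =>
    rw [Finset.sum_insert ha, Finset.biUnion_insert, Finset.card_insert_of_notMem ha]
    have h1 := Finset.card_union_add_card_inter (G.neighborFinset a)
      (S.biUnion fun v => G.neighborFinset v)
    have h2 : (G.neighborFinset a ∩ S.biUnion fun v => G.neighborFinset v).card ≤ S.card := by
      rw [Finset.inter_biUnion]
      refine (Finset.card_biUnion_le_card_mul _ _ 1 ?_).trans (by simp)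
      intro v hv
      exact common_le_one G hg (fun h => ha (h ▸ hv))
    have h1' := congrArg (Nat.cast : ℕ → ℝ) h1
    have h2' : ((G.neighborFinset a ∩ S.biUnion fun v => G.neighborFinset v).card : ℝ)
      ≤ S.card := by exact_mod_cast h2
    push_cast at h1' ⊢
    nlinarith

/-- In a graph on `n` vertices of girth at least 5, there are at most `√n` vertices of
degree exceeding `(3/2)√n`, and the sum of the degrees of these vertices is at most
`(3/2)n`. -/
theorem stmt_10 {V : Type*} [Fintype V] (G : SimpleGraph V) (n : ℕ)
    (hn : Fintype.card V = n) (hg : GirthAtLeastFive G) :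
    (({v : V | (3 / 2) * Real.sqrt n < ((G.neighborSet v).ncard : ℝ)}.ncard : ℝ) ≤
      Real.sqrt n) ∧
    (∑ᶠ v ∈ {v : V | (3 / 2) * Real.sqrt n < ((G.neighborSet v).ncard : ℝ)},
        ((G.neighborSet v).ncard : ℝ)) ≤ (3 / 2) * n := by
  classical
  have hd : ∀ v, (G.neighborSet v).ncard = (G.neighborFinset v).card := fun v => by
    rw [neighborFinset, Set.ncard_eq_toFinset_card']
  simp only [hd]
  set s := Real.sqrt n with hs
  have hs0 : 0 ≤ s := Real.sqrt_nonneg _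
  have hss : s * s = n := Real.mul_self_sqrt (Nat.cast_nonneg n)
  let H : Finset V := Finset.univ.filter fun v => 3 / 2 * s < ((G.neighborFinset v).card : ℝ)
  have hH : {v : V | 3 / 2 * s < ((G.neighborFinset v).card : ℝ)} = (H : Set V) := by
    ext v
    simp only [H, Set.mem_setOf_eq, Finset.mem_coe, Finset.mem_filter, Finset.mem_univ, true_and]
  rw [hH, Set.ncard_coe_finset, finsum_mem_coe_finset]
  have key : ∀ S : Finset V, 2 * ∑ v ∈ S, ((G.neighborFinset v).card : ℝ) ≤
      2 * n + S.card * (S.card - 1) := fun S => by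
    have h := sum_deg_le G hg S
    have h2 : ((S.biUnion fun v => G.neighborFinset v).card : ℝ) ≤ n := by
      rw [← hn]; exact_mod_cast Finset.card_le_univ _
    linarith
  have hk : (H.card : ℝ) ≤ s := by
    by_contra! hlt
    have ht : ⌊s⌋₊ + 1 ≤ H.card := (Nat.floor_lt hs0).2 hlt
    obtain ⟨T, hTH, hT⟩ := Finset.exists_subset_card_eq ht
    have h1 := key T
    have h2 : ∑ v ∈ T, (3 / 2 * s) < ∑ v ∈ T, ((G.neighborFinset v).card : ℝ) := by
      refine Finset.sum_lt_sum_of_nonempty ?_ ?_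
      · rw [← Finset.card_pos]; omega
      · intro v hv
        exact (Finset.mem_filter.1 (hTH hv)).2
    rw [Finset.sum_const, nsmul_eq_mul] at h2
    rw [hT] at h1 h2
    have h3 := Nat.lt_floor_add_one s
    have h4 := Nat.floor_le hs0
    push_cast at h1 h2
    nlinarith
  refine ⟨hk, ?_⟩
  have h := key H
  have h0 : (0 : ℝ) ≤ H.card := Nat.cast_nonneg _
  nlinarith
end

section
/- For a graph G, let s(G) be the maximum size of a set S of vertices of G such that S is a stable set and no vertex of G is adjacent to two vertices of S. For every c > 0 there is n_0 such that for all n ≥ n_0, the number of graphs on vertex set {1,…,n} with girth at least 5 that satisfy s(G) > 3·n^{9/10} is at most 2^{−cn} times the total number of graphs on {1,…,n} with girth at least 5. -/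
open SimpleGraph

/-- `s(G) > x`: there is a stable set `S` of size exceeding `x` such that no vertex of
`G` is adjacent to two vertices of `S`. -/
def HasBigSparseStable {V : Type*} (G : SimpleGraph V) (x : ℝ) : Prop :=
  ∃ S : Set V,
    (∀ v ∈ S, ∀ w ∈ S, ¬ G.Adj v w) ∧
    (∀ u : V, ∀ v ∈ S, ∀ w ∈ S, v ≠ w → ¬ (G.Adj u v ∧ G.Adj u w)) ∧
    x < (S.ncard : ℝ)

/-- Combinatorial form of girth at least five. -/
def NoShort {V : Type*} (G : SimpleGraph V) : Prop :=
  (∀ a b c, G.Adj a b → G.Adj b c → G.Adj c a → False) ∧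
  (∀ a b c d, a ≠ c → b ≠ d → G.Adj a b → G.Adj b c → G.Adj c d → G.Adj d a → False)

theorem girth_iff {V : Type*} (G : SimpleGraph V) : GirthAtLeastFive G ↔ NoShort G := by
  constructor
  · intro h
    refine ⟨fun a b c hab hbc hca => ?_, fun a b c d hac hbd hab hbc hcd hda => ?_⟩
    · have := (h a (.cons hab (.cons hbc (.cons hca .nil))) (by
        have := hab.ne; have := hbc.ne; have := hca.ne
        rw [Walk.cons_isCycle_iff]
        simp [Walk.cons_isPath_iff]
        grind)).1
      simp at this
    · have := (h a (.cons hab (.cons hbc (.cons hcd (.cons hda .nil)))) (by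
        have := hab.ne; have := hbc.ne; have := hcd.ne; have := hda.ne
        rw [Walk.cons_isCycle_iff]
        simp [Walk.cons_isPath_iff]
        grind)).2
      simp at this
  · rintro ⟨h3, h4⟩ v w hw
    constructor
    · intro hl
      match w, hw, hl with
      | .cons h1 (.cons h2 (.cons h3' .nil)), _, _ => exact h3 _ _ _ h1 h2 h3'
    · intro hl
      match w, hw, hl with
      | .cons h1 (.cons h2 (.cons h3' (.cons h4' .nil))), hw, _ =>
        have := hw.support_nodup
        simp at this
        refine h4 _ _ _ _ ?_ ?_ h1 h2 h3' h4' <;> grind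

/-- Replace everything inside `S` by an incidence graph and delete edges leaving `S`. -/
def newGraph {V T : Type*} (p q : T → V) (hpq : ∀ s t, p s ≠ q t) (S : Finset V)
    (G : SimpleGraph V) (E : Set T) : SimpleGraph V where
  Adj u v := (u ∉ S ∧ v ∉ S ∧ G.Adj u v) ∨
    (∃ t ∈ E, (u = p t ∧ v = q t) ∨ (u = q t ∧ v = p t))
  symm := ⟨by
    rintro u v (⟨h1, h2, h3⟩ | ⟨t, ht, h | h⟩)
    · exact Or.inl ⟨h2, h1, h3.symm⟩
    · exact Or.inr ⟨t, ht, Or.inr ⟨h.2, h.1⟩⟩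
    · exact Or.inr ⟨t, ht, Or.inl ⟨h.2, h.1⟩⟩⟩
  loopless := ⟨by
    rintro u (⟨h1, h2, h3⟩ | ⟨t, ht, h | h⟩)
    · exact G.loopless.irrefl _ h3
    · exact hpq t t (h.1.symm.trans h.2)
    · exact hpq t t (h.2.symm.trans h.1)⟩

theorem newGraph_good {V T : Type*} (p q : T → V) (hpq : ∀ s t, p s ≠ q t) (S : Finset V)
    (hp : ∀ t, p t ∈ S) (hq : ∀ t, q t ∈ S)
    (hrect : ∀ t1 t2 t3 t4, p t1 = p t2 → q t2 = q t3 → p t3 = p t4 → q t4 = q t1 →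
      q t1 = q t2 ∨ p t2 = p t3)
    (G : SimpleGraph V) (hG : NoShort G) (E : Set T) : NoShort (newGraph p q hpq S G E) := by
  have out : ∀ u v, u ∉ S → (newGraph p q hpq S G E).Adj u v → v ∉ S ∧ G.Adj u v := by
    rintro u v hu (⟨h1, h2, h3⟩ | ⟨t, ht, h | h⟩)
    · exact ⟨h2, h3⟩
    · exact absurd (h.1 ▸ hp t) hu
    · exact absurd (h.1 ▸ hq t) hu
  have inn : ∀ u v, u ∈ S → (newGraph p q hpq S G E).Adj u v → v ∈ S ∧
      ∃ t, (u = p t ∧ v = q t) ∨ (u = q t ∧ v = p t) := by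
    rintro u v hu (⟨h1, h2, h3⟩ | ⟨t, ht, h | h⟩)
    · exact absurd hu h1
    · exact ⟨h.2 ▸ hq t, t, Or.inl h⟩
    · exact ⟨h.2 ▸ hp t, t, Or.inr h⟩
  constructor
  · intro a b c hab hbc hca
    by_cases ha : a ∈ S
    · obtain ⟨hb, t1, h1⟩ := inn _ _ ha hab
      obtain ⟨hc, t2, h2⟩ := inn _ _ hb hbc
      obtain ⟨-, t3, h3⟩ := inn _ _ hc hca
      grind
    · obtain ⟨hb, h1⟩ := out _ _ ha hab
      obtain ⟨hc, h2⟩ := out _ _ hb hbc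
      obtain ⟨-, h3⟩ := out _ _ hc hca
      exact hG.1 _ _ _ h1 h2 h3
  · intro a b c d hac hbd hab hbc hcd hda
    by_cases ha : a ∈ S
    · obtain ⟨hb, t1, h1⟩ := inn _ _ ha hab
      obtain ⟨hc, t2, h2⟩ := inn _ _ hb hbc
      obtain ⟨hd, t3, h3⟩ := inn _ _ hc hcd
      obtain ⟨-, t4, h4⟩ := inn _ _ hd hda
      rcases h1 with ⟨h1, h1'⟩ | ⟨h1, h1'⟩
      · have e2 : b = q t2 ∧ c = p t2 := by grind
        have e3 : c = p t3 ∧ d = q t3 := by grind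
        have e4 : d = q t4 ∧ a = p t4 := by grind
        have := hrect t4 t1 t2 t3
        grind
      · have e2 : b = p t2 ∧ c = q t2 := by grind
        have e3 : c = q t3 ∧ d = p t3 := by grind
        have e4 : d = p t4 ∧ a = q t4 := by grind
        have := hrect t1 t2 t3 t4
        grind
    · obtain ⟨hb, h1⟩ := out _ _ ha hab
      obtain ⟨hc, h2⟩ := out _ _ hb hbc
      obtain ⟨hd, h3⟩ := out _ _ hc hcd
      obtain ⟨-, h4⟩ := out _ _ hd hda
      exact hG.2 _ _ _ _ hac hbd h1 h2 h3 h4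

/-- `S` is stable and no vertex has two neighbours in `S`. -/
def Sparse {V : Type*} (G : SimpleGraph V) (S : Finset V) : Prop :=
  (∀ v ∈ S, ∀ w ∈ S, ¬ G.Adj v w) ∧
    (∀ u : V, ∀ v ∈ S, ∀ w ∈ S, G.Adj u v → G.Adj u w → v = w)

open Classical in
/-- The neighbour of `u` in `S`, if any. -/
noncomputable def nb {V : Type*} (G : SimpleGraph V) (S : Finset V) (u : V) : Option V :=
  if h : ∃ v ∈ S, G.Adj u v then some h.choose else none

theorem nb_iff {V : Type*} (G : SimpleGraph V) (S : Finset V) (h : Sparse G S) (u v : V)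
    (hv : v ∈ S) : G.Adj u v ↔ nb G S u = some v := by
  unfold nb
  split_ifs with h1
  · have h2 := h1.choose_spec
    constructor
    · intro h3
      rw [h.2 u _ h2.1 v hv h2.2 h3]
    · intro h3
      have : h1.choose = v := by simpa using h3
      rw [← this]; exact h2.2
  · simp only [reduceCtorEq, iff_false]
    exact fun h3 => h1 ⟨v, hv, h3⟩

/-- The index set of incidences. -/
abbrev Inc (k : ℕ) := Fin k × Fin (k ^ 2) × Fin k
/-- Lines and points. -/
abbrev LP (k : ℕ) := (Fin k × Fin (k ^ 2)) ⊕ (Fin k × Fin (2 * k ^ 2))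

theorem card_LP (k : ℕ) : Fintype.card (LP k) = 3 * k ^ 3 := by
  simp; ring

/-- The line of an incidence. -/
def lineOf {k : ℕ} (t : Inc k) : LP k := Sum.inl (t.1, t.2.1)
/-- The point of an incidence. -/
def pointOf {k : ℕ} (t : Inc k) : LP k :=
  Sum.inr (t.2.2, ⟨t.1 * t.2.2 + t.2.1, by
    have h1 := t.1.2; have h2 := t.2.1.2; have h3 := t.2.2.2
    have : (t.1 : ℕ) * t.2.2 ≤ k * k := Nat.mul_le_mul h1.le h3.le
    nlinarith⟩)

theorem rect_free {k : ℕ} (t1 t2 t3 t4 : Inc k) (h12 : lineOf t1 = lineOf t2)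
    (h23 : pointOf t2 = pointOf t3) (h34 : lineOf t3 = lineOf t4)
    (h41 : pointOf t4 = pointOf t1) : pointOf t1 = pointOf t2 ∨ lineOf t2 = lineOf t3 := by
  obtain ⟨⟨a1, _⟩, ⟨b1, _⟩, ⟨x1, _⟩⟩ := t1
  obtain ⟨⟨a2, _⟩, ⟨b2, _⟩, ⟨x2, _⟩⟩ := t2
  obtain ⟨⟨a3, _⟩, ⟨b3, _⟩, ⟨x3, _⟩⟩ := t3
  obtain ⟨⟨a4, _⟩, ⟨b4, _⟩, ⟨x4, _⟩⟩ := t4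
  simp only [lineOf, pointOf, Sum.inl.injEq, Sum.inr.injEq, Prod.mk.injEq, Fin.mk.injEq] at *
  obtain ⟨rfl, rfl⟩ := h12
  obtain ⟨rfl, rfl⟩ := h34
  obtain ⟨rfl, e1⟩ := h23
  obtain ⟨rfl, e2⟩ := h41
  by_cases hx : x4 = x2
  · left; subst hx; simp
  · right
    have e1' : (a1 : ℤ) * x2 + b1 = a3 * x2 + b3 := by exact_mod_cast e1
    have e2' : (a3 : ℤ) * x4 + b3 = a1 * x4 + b1 := by exact_mod_cast e2
    have hx' : (x4 : ℤ) - x2 ≠ 0 := by omega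
    have h0 : ((a1 : ℤ) - a3) * (x4 - x2) = 0 := by linarith
    have ha : a1 = a3 := by
      rcases mul_eq_zero.1 h0 with h | h
      · omega
      · exact absurd h hx'
    subst ha
    exact ⟨rfl, by omega⟩

theorem inc_inj {k : ℕ} (s t : Inc k) (h1 : lineOf s = lineOf t) (h2 : pointOf s = pointOf t) :
    s = t := by
  simp only [lineOf, pointOf, Sum.inl.injEq, Sum.inr.injEq, Prod.mk.injEq] at *
  grind

theorem exists_emb (n k : ℕ) (S : Finset (Fin n)) (hS : S.card = 3 * k ^ 3) :
    ∃ e : LP k → Fin n, Function.Injective e ∧ ∀ x, e x ∈ S := by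
  have hc : Fintype.card (LP k) = Fintype.card S := by
    rw [card_LP, Fintype.card_coe, hS]
  let e := Fintype.equivOfCardEq hc
  exact ⟨fun x => (e x : Fin n), Subtype.val_injective.comp e.injective, fun x => (e x).2⟩

theorem newGraph_mem {V T : Type*} (p q : T → V) (hpq : ∀ s t, p s ≠ q t) (S : Finset V)
    (hp : ∀ t, p t ∈ S) (hinj : ∀ s t, p s = p t → q s = q t → s = t)
    (G : SimpleGraph V) (E : Set T) (t : T) :
    (newGraph p q hpq S G E).Adj (p t) (q t) ↔ t ∈ E := by
  constructor
  · rintro (⟨h, -⟩ | ⟨s, hs, h | h⟩)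
    · exact absurd (hp t) h
    · rw [hinj t s h.1 h.2]; exact hs
    · exact absurd h.1 (hpq _ _)
  · exact fun h => Or.inr ⟨t, h, Or.inl ⟨rfl, rfl⟩⟩

theorem newGraph_off {V T : Type*} (p q : T → V) (hpq : ∀ s t, p s ≠ q t) (S : Finset V)
    (hp : ∀ t, p t ∈ S) (hq : ∀ t, q t ∈ S)
    (G : SimpleGraph V) (E : Set T) (u v : V) (hu : u ∉ S) (hv : v ∉ S) :
    (newGraph p q hpq S G E).Adj u v ↔ G.Adj u v := by
  constructor
  · rintro (⟨-, -, h⟩ | ⟨s, hs, h | h⟩)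
    · exact h
    · exact absurd (h.1 ▸ hp s) hu
    · exact absurd (h.1 ▸ hq s) hu
  · exact fun h => Or.inl ⟨hu, hv, h⟩

theorem recover {V T : Type*} (p q : T → V) (hpq : ∀ s t, p s ≠ q t) (S : Finset V)
    (hp : ∀ t, p t ∈ S) (hq : ∀ t, q t ∈ S)
    (hinj : ∀ s t, p s = p t → q s = q t → s = t)
    (G G' : SimpleGraph V) (E E' : Set T) (hG : Sparse G S) (hG' : Sparse G' S)
    (h1 : newGraph p q hpq S G E = newGraph p q hpq S G' E') (h2 : nb G S = nb G' S) :
    G = G' ∧ E = E' := by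
  constructor
  · ext u v
    by_cases hv : v ∈ S
    · rw [nb_iff G S hG u v hv, nb_iff G' S hG' u v hv, h2]
    · by_cases hu : u ∈ S
      · rw [G.adj_comm, G'.adj_comm, nb_iff G S hG v u hu, nb_iff G' S hG' v u hu, h2]
      · rw [← newGraph_off p q hpq S hp hq G E u v hu hv, h1,
          newGraph_off p q hpq S hp hq G' E' u v hu hv]
  · ext t
    rw [← newGraph_mem p q hpq S hp hinj G E t, h1, newGraph_mem p q hpq S hp hinj G' E' t]

theorem count (n k : ℕ) (B : Set (SimpleGraph (Fin n)))
    (hB : ∀ G ∈ B, NoShort G ∧ ∃ S : Finset (Fin n), S.card = 3 * k ^ 3 ∧ Sparse G S) :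
    B.ncard * 2 ^ (k ^ 4) ≤
      {G : SimpleGraph (Fin n) | GirthAtLeastFive G}.ncard * ((n + 1) ^ n * 2 ^ n) := by
  classical
  choose! hgood σ hcard hsp using hB
  choose e he heS using exists_emb n k
  let p (S : {S : Finset (Fin n) // S.card = 3 * k ^ 3}) (t : Inc k) : Fin n :=
    e S.1 S.2 (lineOf t)
  let q (S : {S : Finset (Fin n) // S.card = 3 * k ^ 3}) (t : Inc k) : Fin n :=
    e S.1 S.2 (pointOf t)
  have hpq : ∀ S s t, p S s ≠ q S t := by
    intro S s t h
    have := he S.1 S.2 h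
    simp [lineOf, pointOf] at this
  have hinj : ∀ S s t, p S s = p S t → q S s = q S t → s = t := fun S s t h1 h2 =>
    inc_inj s t (he S.1 S.2 h1) (he S.1 S.2 h2)
  let τ (G : B) : {S : Finset (Fin n) // S.card = 3 * k ^ 3} := ⟨σ G.1, hcard G.1 G.2⟩
  let F : B × Set (Inc k) → {G : SimpleGraph (Fin n) | GirthAtLeastFive G} ×
      ((Fin n → Option (Fin n)) × Finset (Fin n)) := fun x =>
    (⟨newGraph (p (τ x.1)) (q (τ x.1)) (hpq _) (τ x.1).1 x.1.1 x.2,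
      (girth_iff _).2 (newGraph_good _ _ _ _ (fun t => heS _ _ _) (fun t => heS _ _ _)
        (by
          intro t1 t2 t3 t4 h1 h2 h3 h4
          have hh := he (τ x.1).1 (τ x.1).2
          exact (rect_free t1 t2 t3 t4 (hh h1) (hh h2) (hh h3) (hh h4)).imp
            (fun h => congrArg _ h) (fun h => congrArg _ h))
        _ (hgood x.1.1 x.1.2) _)⟩,
      (nb x.1.1 (τ x.1).1, (τ x.1).1))
  have hF : Function.Injective F := by
    rintro ⟨G, E⟩ ⟨G', E'⟩ h
    simp only [F, Prod.mk.injEq, Subtype.mk.injEq] at h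
    obtain ⟨h1, h2, h3⟩ := h
    have h3' : τ G = τ G' := Subtype.ext h3
    have hs' := hsp G'.1 G'.2
    have hs : Sparse G.1 (τ G).1 := hsp G.1 G.2
    change Sparse G'.1 (τ G').1 at hs'
    rw [h3'] at h2 hs
    have h1' : newGraph (p (τ G')) (q (τ G')) (hpq _) (τ G').1 G.1 E =
        newGraph (p (τ G')) (q (τ G')) (hpq _) (τ G').1 G'.1 E' := by
      rw [← h1]; congr 1 <;> rw [h3']
    obtain ⟨a, b⟩ := recover _ _ _ _ (fun t => heS _ _ _) (fun t => heS _ _ _) (hinj _)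
      _ _ _ _ hs hs' h1' h2
    exact Prod.ext (Subtype.ext a) b
  have := Nat.card_le_card_of_injective F hF
  simp only [Nat.card_prod, Nat.card_coe_set_eq] at this
  have c1 : Nat.card (Set (Inc k)) = 2 ^ (k ^ 4) := by
    rw [Nat.card_eq_fintype_card, Fintype.card_set]
    congr 1
    simp; ring
  have c2 : Nat.card (Fin n → Option (Fin n)) = (n + 1) ^ n := by
    rw [Nat.card_eq_fintype_card]; simp
  have c3 : Nat.card (Finset (Fin n)) = 2 ^ n := by
    rw [Nat.card_eq_fintype_card]; simp
  rwa [c1, c2, c3] at this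

theorem numeric (c : ℝ) (hc : 0 < c) (n : ℕ) (x : ℝ) (hx : 192 + 16 * c ≤ x)
    (hn : (n : ℝ) = x ^ 10) :
    ((n + 1 : ℝ) ^ n * 2 ^ n) ≤ (2 : ℝ) ^ (-(c * n)) * 2 ^ (⌊x ^ 3⌋₊ ^ 4) := by
  have hx1 : 1 ≤ x := by linarith
  have hx0 : 0 ≤ x := by linarith
  have hn1 : (1 : ℝ) ≤ n := by rw [hn]; exact one_le_pow₀ hx1
  have h2x : x ≤ (2 : ℝ) ^ x := by
    have := one_add_mul_self_le_rpow_one_add (s := 1) (by norm_num) (p := x) hx1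
    norm_num at this; linarith
  have hb : (n + 1 : ℝ) ≤ (2 : ℝ) ^ (1 + 10 * x) := by
    calc (n + 1 : ℝ) ≤ 2 * x ^ 10 := by linarith
      _ ≤ 2 * ((2 : ℝ) ^ x) ^ 10 := by gcongr
      _ = (2 : ℝ) ^ (1 + 10 * x) := by
        rw [Real.rpow_add (by norm_num), Real.rpow_one, mul_comm (10 : ℝ) x,
          Real.rpow_mul (by norm_num)]
        congr 1
        exact_mod_cast (Real.rpow_natCast ((2 : ℝ) ^ x) 10).symm
  have hk : x ^ 3 / 2 ≤ (⌊x ^ 3⌋₊ : ℝ) := by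
    have h1 := Nat.lt_floor_add_one (x ^ 3)
    have h2 : x ≤ x ^ 3 := le_self_pow₀ hx1 (by norm_num)
    linarith
  have hk4 : x ^ 12 / 16 ≤ (⌊x ^ 3⌋₊ : ℝ) ^ 4 := by
    calc x ^ 12 / 16 = (x ^ 3 / 2) ^ 4 := by ring
      _ ≤ _ := by gcongr
  have hquad : 2 + c + 10 * x ≤ x ^ 2 / 16 := by nlinarith
  have hexp : (1 + 10 * x) * n + n ≤ -(c * n) + ((⌊x ^ 3⌋₊ ^ 4 : ℕ) : ℝ) := by
    push_cast
    have : (n : ℝ) * (2 + c + 10 * x) ≤ n * (x ^ 2 / 16) := by gcongr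
    have h3 : (n : ℝ) * (x ^ 2 / 16) = x ^ 12 / 16 := by rw [hn]; ring
    nlinarith
  calc ((n + 1 : ℝ) ^ n * 2 ^ n) ≤ ((2 : ℝ) ^ (1 + 10 * x)) ^ n * 2 ^ n := by gcongr
    _ = (2 : ℝ) ^ ((1 + 10 * x) * n + n) := by
      rw [Real.rpow_add (by norm_num) ((1 + 10 * x) * n) n,
        Real.rpow_mul (by norm_num) (1 + 10 * x) n, Real.rpow_natCast, Real.rpow_natCast]
    _ ≤ (2 : ℝ) ^ (-(c * n) + ((⌊x ^ 3⌋₊ ^ 4 : ℕ) : ℝ)) :=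
      Real.rpow_le_rpow_of_exponent_le (by norm_num) hexp
    _ = _ := by rw [Real.rpow_add (by norm_num), Real.rpow_natCast]

/-- For every `c > 0`, for all sufficiently large `n`, the proportion of graphs of
girth at least 5 on `{1,…,n}` with `s(G) > 3 n^{9/10}` is at most `2^{-cn}`. -/
theorem stmt_11 (c : ℝ) (hc : 0 < c) :
    ∃ n0 : ℕ, ∀ n : ℕ, n0 ≤ n →
      (({G : SimpleGraph (Fin n) | GirthAtLeastFive G ∧
          HasBigSparseStable G (3 * (n : ℝ) ^ ((9 : ℝ) / 10))}.ncard : ℝ) ≤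
        (2 : ℝ) ^ (-(c * n)) *
          ({G : SimpleGraph (Fin n) | GirthAtLeastFive G}.ncard : ℝ)) := by
  classical
  refine ⟨⌈(192 + 16 * c) ^ 10⌉₊, fun n hn => ?_⟩
  set x : ℝ := (n : ℝ) ^ ((1 : ℝ) / 10) with hxdef
  have hn0 : (0 : ℝ) ≤ n := Nat.cast_nonneg n
  have hx0 : 0 ≤ x := Real.rpow_nonneg hn0 _
  have hnx : (n : ℝ) = x ^ 10 := by
    rw [hxdef, ← Real.rpow_natCast, ← Real.rpow_mul hn0]; norm_num
  have h9 : (n : ℝ) ^ ((9 : ℝ) / 10) = x ^ 9 := by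
    rw [hxdef, ← Real.rpow_natCast, ← Real.rpow_mul hn0]; norm_num
  have hx : 192 + 16 * c ≤ x := by
    have h1 : (192 + 16 * c) ^ 10 ≤ x ^ 10 := by
      rw [← hnx]; exact Nat.ceil_le.1 hn
    exact le_of_pow_le_pow_left₀ (by norm_num) hx0 h1
  have hnum := numeric c hc n x hx hnx
  have hcount := count n ⌊x ^ 3⌋₊ {G : SimpleGraph (Fin n) | GirthAtLeastFive G ∧
          HasBigSparseStable G (3 * (n : ℝ) ^ ((9 : ℝ) / 10))} (by
    rintro G ⟨hG, S, hS1, hS2, hS3⟩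
    refine ⟨(girth_iff G).1 hG, ?_⟩
    have hle : 3 * ⌊x ^ 3⌋₊ ^ 3 ≤ S.toFinset.card := by
      rw [← Set.ncard_eq_toFinset_card']
      have hf : (⌊x ^ 3⌋₊ : ℝ) ≤ x ^ 3 := Nat.floor_le (by positivity)
      have : (⌊x ^ 3⌋₊ : ℝ) ^ 3 ≤ (x ^ 3) ^ 3 := by gcongr
      rw [h9] at hS3
      have h5 : ((3 * ⌊x ^ 3⌋₊ ^ 3 : ℕ) : ℝ) ≤ (S.ncard : ℝ) := by
        push_cast; nlinarith
      exact_mod_cast h5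
    obtain ⟨S', hS', hc'⟩ := Finset.exists_subset_card_eq hle
    have hm : ∀ v ∈ S', v ∈ S := fun v hv => Set.mem_toFinset.1 (hS' hv)
    refine ⟨S', hc', fun v hv w hw => hS1 v (hm v hv) w (hm w hw), ?_⟩
    intro u v hv w hw h1 h2
    by_contra hne
    exact hS2 u v (hm v hv) w (hm w hw) hne ⟨h1, h2⟩)
  set b := {G : SimpleGraph (Fin n) | GirthAtLeastFive G ∧
          HasBigSparseStable G (3 * (n : ℝ) ^ ((9 : ℝ) / 10))}.ncard
  set g := {G : SimpleGraph (Fin n) | GirthAtLeastFive G}.ncard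
  have hcount' : (b : ℝ) * 2 ^ (⌊x ^ 3⌋₊ ^ 4) ≤ g * ((n + 1 : ℝ) ^ n * 2 ^ n) := by
    exact_mod_cast hcount
  have hpos : (0 : ℝ) < 2 ^ (⌊x ^ 3⌋₊ ^ 4) := by positivity
  refine le_of_mul_le_mul_right (hcount'.trans ?_) hpos
  calc (g : ℝ) * ((n + 1 : ℝ) ^ n * 2 ^ n)
      ≤ g * ((2 : ℝ) ^ (-(c * n)) * 2 ^ (⌊x ^ 3⌋₊ ^ 4)) := by gcongr
    _ = _ := by ring
end

section
/- Let p_n be the number of partitions of the set {1,…,n} having more than n/√(ln n) parts. Then p_n/B_n = o(2^{−n·(ln n)^{1/3}}); that is, 2^{n·(ln n)^{1/3}} · p_n / B_n tends to 0 as n tends to infinity. -/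
open Filter

/-- The Bell number: the number of partitions of `{1,…,n}`. -/
noncomputable def bellNum (n : ℕ) : ℕ :=
  Nat.card (Finpartition (Finset.univ : Finset (Fin n)))

/-- The number of partitions of `{1,…,n}` having more than `n/√(ln n)` parts. -/
noncomputable def manyPartsCount (n : ℕ) : ℕ :=
  Nat.card {P : Finpartition (Finset.univ : Finset (Fin n)) //
    (n : ℝ) / Real.sqrt (Real.log n) < (P.parts.card : ℝ)}

lemma finpart_ext_part {n : ℕ} {P Q : Finpartition (Finset.univ : Finset (Fin n))}
    (h : ∀ a b, a ∈ P.part b ↔ a ∈ Q.part b) : P = Q := by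
  have key : ∀ R : Finpartition (Finset.univ : Finset (Fin n)),
      R.parts = Finset.univ.image R.part := by
    intro R
    ext t
    simp only [Finset.mem_image, Finset.mem_univ, true_and]
    constructor
    · intro ht
      obtain ⟨a, ha⟩ := R.nonempty_of_mem_parts ht
      exact ⟨a, R.part_eq_of_mem ht ha⟩
    · rintro ⟨a, rfl⟩
      exact R.part_mem.2 (Finset.mem_univ a)
  have h2 : P.part = Q.part := by
    funext b
    ext a
    exact h a b
  apply Finpartition.ext
  rw [key P, key Q, h2]

lemma bell_lower (n m : ℕ) (hmn : m ≤ n) : m ^ (n - m) ≤ bellNum n := by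
  classical
  let F : (Fin (n - m) → Fin m) → Fin n → Fin m := fun g i =>
    if h : (i : ℕ) < m then ⟨i, h⟩ else g ⟨i - m, by omega⟩
  let Pt : (Fin (n - m) → Fin m) → Finpartition (Finset.univ : Finset (Fin n)) := fun g =>
    Finpartition.ofSetoid (Setoid.ker (F g))
  have hP : ∀ g a b, b ∈ (Pt g).part a ↔ F g a = F g b := by
    intro g a b
    exact Finpartition.mem_part_ofSetoid_iff_rel
  have hinj : Function.Injective Pt := by
    intro g g' h
    funext j
    let a : Fin n := ⟨j + m, by omega⟩
    let b : Fin n := ⟨g j, by omega⟩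
    have ha : ∀ g, F g a = g j := by
      intro g
      simp [F, a]
    have hb : ∀ g', F g' b = g j := by
      intro g'
      simp [F, b]
    have h1 : b ∈ (Pt g).part a := by
      rw [hP, ha, hb]
    rw [h, hP, ha, hb] at h1
    exact h1.symm
  have := Nat.card_le_card_of_injective Pt hinj
  simpa [bellNum] using this

lemma exists_code {n : ℕ} (P : Finpartition (Finset.univ : Finset (Fin n))) :
    ∃ (L : Finset (Fin n)) (f : Fin n → Fin n), L.card = P.parts.card ∧
      (∀ a ∈ L, f a = a) ∧ ∀ a b, a ∈ P.part b ↔ f a = f b := by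
  obtain ⟨r, -, hr⟩ := P.exists_subset_part_bijOn
  have hex : ∀ a, ∃ c ∈ r, P.part c = P.part a := by
    intro a
    exact hr.surjOn (P.part_mem.2 (Finset.mem_univ a))
  choose f hf1 hf2 using hex
  refine ⟨r, f, ?_, ?_, ?_⟩
  · exact Finset.card_nbij P.part (fun a ha => hr.mapsTo ha) hr.injOn hr.surjOn
  · intro a ha
    exact hr.injOn (hf1 a) ha (hf2 a)
  · intro a b
    rw [P.mem_part_iff_part_eq_part (Finset.mem_univ a) (Finset.mem_univ b)]
    constructor
    · intro h
      exact hr.injOn (hf1 a) (hf1 b) (by rw [hf2, hf2, h])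
    · intro h
      rw [← hf2 a, ← hf2 b, h]

lemma many_upper (n : ℕ) (hn : 1 ≤ n) (t : ℝ) :
    (Nat.card {P : Finpartition (Finset.univ : Finset (Fin n)) // t < (P.parts.card : ℝ)} : ℝ)
      ≤ 2 ^ n * (n : ℝ) ^ ((n : ℝ) - t) := by
  classical
  choose L f hL hf hP using fun P : Finpartition (Finset.univ : Finset (Fin n)) => exists_code P
  let S := {P : Finpartition (Finset.univ : Finset (Fin n)) // t < (P.parts.card : ℝ)}
  have h1 : Nat.card S = ∑ A : Finset (Fin n),
      ((Finset.univ : Finset S).filter (fun P => L P.1 = A)).card := by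
    rw [Nat.card_eq_fintype_card, ← Finset.card_univ]
    exact Finset.card_eq_sum_card_fiberwise (fun _ _ => Finset.mem_coe.2 (Finset.mem_univ _))
  have hn1 : (1 : ℝ) ≤ n := by exact_mod_cast hn
  have h2 : ∀ A : Finset (Fin n),
      (((Finset.univ : Finset S).filter (fun P => L P.1 = A)).card : ℝ)
        ≤ (n : ℝ) ^ ((n : ℝ) - t) := by
    intro A
    rcases Finset.eq_empty_or_nonempty
      ((Finset.univ : Finset S).filter (fun P => L P.1 = A)) with h0 | ⟨P0, hP0⟩
    · rw [h0]
      simp only [Finset.card_empty, Nat.cast_zero]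
      positivity
    have hA : t < (A.card : ℝ) := by
      have := P0.2
      rw [← hL] at this
      rwa [(Finset.mem_filter.1 hP0).2] at this
    have hc : ((Finset.univ : Finset S).filter (fun P => L P.1 = A)).card
        ≤ (Finset.univ : Finset ({x // x ∉ A} → Fin n)).card := by
      apply Finset.card_le_card_of_injOn (fun P x => f P.1 x.1)
      · intro _ _
        simp
      · intro P hPm Q hQm h
        have hPA := (Finset.mem_filter.1 hPm).2
        have hQA := (Finset.mem_filter.1 hQm).2
        have hff : f P.1 = f Q.1 := by
          funext x
          by_cases hx : x ∈ A
          · rw [hf P.1 x (by rw [hPA]; exact hx), hf Q.1 x (by rw [hQA]; exact hx)]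
          · exact congrFun h ⟨x, hx⟩
        apply Subtype.ext
        apply finpart_ext_part
        intro a b
        rw [hP, hP, hff]
    have hcard : (Finset.univ : Finset ({x // x ∉ A} → Fin n)).card = n ^ (n - A.card) := by
      rw [Finset.card_univ, Fintype.card_fun, Fintype.card_fin, Fintype.card_subtype_compl]
      simp
    rw [hcard] at hc
    have hAn : A.card ≤ n := by simpa using A.card_le_univ
    calc (((Finset.univ : Finset S).filter (fun P => L P.1 = A)).card : ℝ)
        ≤ (n : ℝ) ^ (n - A.card) := by exact_mod_cast hc
      _ = (n : ℝ) ^ (((n - A.card : ℕ)) : ℝ) := (Real.rpow_natCast _ _).symm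
      _ ≤ (n : ℝ) ^ ((n : ℝ) - t) := by
          apply Real.rpow_le_rpow_of_exponent_le hn1
          rw [Nat.cast_sub hAn]
          linarith
  change (Nat.card S : ℝ) ≤ _
  rw [h1, Nat.cast_sum]
  calc _ ≤ ∑ A : Finset (Fin n), (n : ℝ) ^ ((n : ℝ) - t) := Finset.sum_le_sum (fun A _ => h2 A)
    _ = _ := by simp

lemma asymp : ∀ᶠ x : ℝ in atTop, x ^ ((1 : ℝ) / 3) + Real.log x + 4 ≤ Real.sqrt x := by
  have e1 := (tendsto_rpow_atTop (show (0 : ℝ) < 1 / 6 by norm_num)).eventually_ge_atTop 4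
  have e2 := (tendsto_rpow_atTop (show (0 : ℝ) < 1 / 2 by norm_num)).eventually_ge_atTop 16
  have e3 := (isLittleO_log_rpow_atTop (show (0 : ℝ) < 1 / 2 by norm_num)).bound
    (show (0 : ℝ) < 1 / 4 by norm_num)
  filter_upwards [e1, e2, e3, eventually_ge_atTop 1] with x h1 h2 h3 h4
  rw [Real.sqrt_eq_rpow]
  have h5 : x ^ ((1 : ℝ) / 2) = x ^ ((1 : ℝ) / 3) * x ^ ((1 : ℝ) / 6) := by
    rw [← Real.rpow_add (by linarith)]
    norm_num
  have h6 : 0 ≤ x ^ ((1 : ℝ) / 3) := by positivity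
  rw [Real.norm_eq_abs, Real.norm_eq_abs, abs_of_nonneg (by positivity : 0 ≤ x ^ ((1 : ℝ) / 2))]
    at h3
  have := le_abs_self (Real.log x)
  nlinarith

lemma final_bound (n : ℕ) (hn : 1 ≤ n) (hx : 1 ≤ Real.log n)
    (h : (Real.log n) ^ ((1 : ℝ) / 3) + Real.log (Real.log n) + 4 ≤ Real.sqrt (Real.log n)) :
    (2 : ℝ) ^ ((n : ℝ) * (Real.log n) ^ ((1 : ℝ) / 3)) *
          (manyPartsCount n : ℝ) / (bellNum n : ℝ) ≤ Real.exp (-(n : ℝ)) := by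
  have hn0 : (1 : ℝ) ≤ n := by exact_mod_cast hn
  set x := Real.log n with hxdef
  have hxn : x ≤ n := (Real.log_le_sub_one_of_pos (by linarith)).trans (by linarith)
  set m := ⌈(n : ℝ) / x⌉₊ with hm
  have hm1 : (n : ℝ) / x ≤ m := Nat.le_ceil _
  have hm2 : (m : ℝ) < n / x + 1 := Nat.ceil_lt_add_one (by positivity)
  have hmn : m ≤ n := by
    apply Nat.ceil_le.2
    exact div_le_self (by linarith) hx
  have hmn' : (m : ℝ) ≤ n := by exact_mod_cast hmn
  have hquot : 0 < (n : ℝ) / x := by positivity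
  have hm0 : (0 : ℝ) < m := by linarith
  have hlm : x - Real.log x ≤ Real.log m := by
    have := Real.log_le_log hquot hm1
    rwa [Real.log_div (by linarith) (by linarith)] at this
  have hlx : 0 ≤ Real.log x := Real.log_nonneg hx
  have hlx2 : Real.log x ≤ x - 1 := Real.log_le_sub_one_of_pos (by linarith)
  have hB : Real.exp (n * x - n * Real.log x - n - x) ≤ bellNum n := by
    have hb : ((m ^ (n - m) : ℕ) : ℝ) ≤ bellNum n := by exact_mod_cast bell_lower n m hmn
    refine le_trans ?_ hb
    rw [Nat.cast_pow, ← Real.rpow_natCast, Real.rpow_def_of_pos hm0, Nat.cast_sub hmn]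
    apply Real.exp_le_exp.2
    have hq : (n : ℝ) / x * x = n := by field_simp
    have s1 : ((n : ℝ) - m) * (x - Real.log x) ≤ (n - m) * Real.log m :=
      mul_le_mul_of_nonneg_left hlm (by linarith)
    have s2 : (m : ℝ) * (x - Real.log x) ≤ (n / x + 1) * x :=
      mul_le_mul hm2.le (by linarith) (by linarith) (by positivity)
    nlinarith
  have hU : (manyPartsCount n : ℝ) ≤ Real.exp (n + (n * x - n * Real.sqrt x)) := by
    refine (many_upper n hn _).trans ?_
    rw [Real.exp_add]
    have t1 : (2 : ℝ) ^ n ≤ Real.exp n := by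
      rw [← Real.exp_one_pow]
      apply pow_le_pow_left₀ (by norm_num)
      have := Real.add_one_le_exp (1 : ℝ)
      linarith
    have t2 : (n : ℝ) ^ ((n : ℝ) - n / Real.sqrt x) = Real.exp (n * x - n * Real.sqrt x) := by
      rw [Real.rpow_def_of_pos (by linarith), ← hxdef]
      congr 1
      have hs : 0 < Real.sqrt x := Real.sqrt_pos.2 (by linarith)
      have hss : Real.sqrt x * Real.sqrt x = x := Real.mul_self_sqrt (by linarith)
      have : x * (n / Real.sqrt x) = n * Real.sqrt x := by
        field_simp
        nlinarith
      rw [mul_sub, this]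
      ring
    rw [t2]
    gcongr
  have h2 : (2 : ℝ) ^ ((n : ℝ) * x ^ ((1 : ℝ) / 3)) ≤ Real.exp (n * x ^ ((1 : ℝ) / 3)) := by
    rw [← Real.exp_one_rpow]
    apply Real.rpow_le_rpow (by norm_num) _ (by positivity)
    have := Real.add_one_le_exp (1 : ℝ)
    linarith
  have hBpos : (0 : ℝ) < bellNum n := lt_of_lt_of_le (Real.exp_pos _) hB
  rw [div_le_iff₀ hBpos]
  calc _ ≤ Real.exp (n * x ^ ((1 : ℝ) / 3)) * Real.exp (n + (n * x - n * Real.sqrt x)) := by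
        gcongr
    _ = Real.exp (n * x ^ ((1 : ℝ) / 3) + (n + (n * x - n * Real.sqrt x))) :=
        (Real.exp_add _ _).symm
    _ ≤ Real.exp (-n + (n * x - n * Real.log x - n - x)) := by
        apply Real.exp_le_exp.2
        have := mul_le_mul_of_nonneg_left h (by linarith : (0 : ℝ) ≤ n)
        nlinarith
    _ = Real.exp (-n) * Real.exp (n * x - n * Real.log x - n - x) := Real.exp_add _ _
    _ ≤ _ := by gcongr

/-- The proportion of partitions of `{1,…,n}` with more than `n/√(ln n)` parts is
`o(2^{-n (ln n)^{1/3}})`. -/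
theorem stmt_16 :
    Tendsto
      (fun n : ℕ =>
        (2 : ℝ) ^ ((n : ℝ) * (Real.log n) ^ ((1 : ℝ) / 3)) *
          (manyPartsCount n : ℝ) / (bellNum n : ℝ))
      atTop (nhds 0) := by
  have hlog : Tendsto (fun n : ℕ => Real.log (n : ℝ)) atTop atTop :=
    Real.tendsto_log_atTop.comp tendsto_natCast_atTop_atTop
  have hexp : Tendsto (fun n : ℕ => Real.exp (-(n : ℝ))) atTop (nhds 0) :=
    Real.tendsto_exp_neg_atTop_nhds_zero.comp tendsto_natCast_atTop_atTop
  refine tendsto_of_tendsto_of_tendsto_of_le_of_le' tendsto_const_nhds hexp ?_ ?_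
  · exact Eventually.of_forall (fun n => by positivity)
  · filter_upwards [eventually_ge_atTop 1, hlog.eventually_ge_atTop 1, hlog.eventually asymp]
      with n h1 h2 h3
    exact final_bound n h1 h2 h3
end
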